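/- arXiv:2508.20825 — 4 statements merged into one kernel-verified Lean document; each statement's English description precedes it below -/
import Mathlib

section
/- Any triangle-free graph on n vertices contains at most (n/5)⁵ cycles of length 5, where the count is the number of 5-element vertex subsets inducing a copy of C₅. -/
namespace Pentagon

open Finset

/-- A positive semidefinite quadratic form in the neighbourhoods `u`, `v` of two vertices inside a
triple of root vertices. The triple `t` records the adjacencies `01`, `02`, `12` between the
roots. -/
def flagForm (t u v : Bool × Bool × Bool) : ℤ :=
  match t with
  | (false, false, false) => 24 * (emptyA u * emptyA v) + 168 * (emptyB u * emptyB v)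
  | (true, false, false) =>
      9 * (edgeA u * edgeA v) + 993 * (edgeB u * edgeB v) +
        342 * (edgeC u * edgeC v) + 8658 * (edgeD u * edgeD v)
  | (false, true, true) =>
      768 * (pathA u * pathA v) + 186 * (pathB u * pathB v) + 7722 * (pathC u * pathC v)
  | _ => 0
where
  emptyA : Bool × Bool × Bool → ℤ
    | (false, false, false) => 2
    | (true, false, false) | (false, true, false) | (false, false, true) => -5
    | (false, true, true) | (true, false, true) | (true, true, false) => 4
    | (true, true, true) => -3
  emptyB : Bool × Bool × Bool → ℤ
    | (true, false, false) | (false, true, false) | (false, false, true) => 1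
    | (false, true, true) | (true, false, true) | (true, true, false) => -1
    | _ => 0
  edgeA : Bool × Bool × Bool → ℤ
    | (false, false, false) => 16
    | (true, false, false) | (false, true, false) => -9
    | (false, false, true) => -20
    | (true, false, true) | (false, true, true) => 1
    | _ => 0
  edgeB : Bool × Bool × Bool → ℤ
    | (true, false, false) | (false, true, false) => 1
    | (false, false, true) => -2
    | (true, false, true) | (false, true, true) => -1
    | _ => 0
  edgeC : Bool × Bool × Bool → ℤ
    | (true, false, false) => 1
    | (false, true, false) => -1
    | _ => 0
  edgeD : Bool × Bool × Bool → ℤ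
    | (true, false, true) => 1
    | (false, true, true) => -1
    | _ => 0
  pathA : Bool × Bool × Bool → ℤ
    | (false, false, false) => -2
    | (true, false, false) | (false, true, false) => -1
    | (false, false, true) => 1
    | _ => 0
  pathB : Bool × Bool × Bool → ℤ
    | (false, false, false) => -4
    | (true, false, false) | (false, true, false) => -1
    | (true, true, false) => 2
    | _ => 0
  pathC : Bool × Bool × Bool → ℤ
    | (true, false, false) => 1
    | (false, true, false) => -1
    | _ => 0

/-- The sum of `flagForm` over the three choices of the root listed last. -/
def symmFlagForm : (t u v : Bool × Bool × Bool) → ℤ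
  | (t₁, t₂, t₃), (u₁, u₂, u₃), (v₁, v₂, v₃) =>
      flagForm (t₁, t₂, t₃) (u₁, u₂, u₃) (v₁, v₂, v₃) +
        flagForm (t₂, t₁, t₃) (u₁, u₃, u₂) (v₁, v₃, v₂) +
        flagForm (t₃, t₁, t₂) (u₂, u₃, u₁) (v₂, v₃, v₁)

theorem sum_sum_flagForm_nonneg {ι : Type*} [Fintype ι] (t : Bool × Bool × Bool)
    (u : ι → Bool × Bool × Bool) : 0 ≤ ∑ y, ∑ z, flagForm t (u y) (u z) := by
  obtain ⟨_ | _, _ | _, _ | _⟩ := t <;>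
    simp only [flagForm, sum_add_distrib, ← mul_sum, ← sum_mul, sum_const_zero, le_refl] <;>
    simp only [← pow_two] <;> positivity

/-- The adjacencies of a triangle-free graph on the vertices `0, …, 4` are listed
lexicographically as `a, …, j`. -/
theorem symmFlagForm_le : ∀ a b c d e f g h i j : Bool,
    (a && b && e) = false ∧ (a && c && f) = false ∧
    (a && d && g) = false ∧ (b && c && h) = false ∧
    (b && d && i) = false ∧ (c && d && j) = false ∧
    (e && f && h) = false ∧ (e && g && i) = false ∧
    (f && g && j) = false ∧ (h && i && j) = false →
    (if a.toNat + b.toNat + c.toNat + d.toNat = 2 ∧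
        a.toNat + e.toNat + f.toNat + g.toNat = 2 ∧
        b.toNat + e.toNat + h.toNat + i.toNat = 2 ∧
        c.toNat + f.toNat + h.toNat + j.toNat = 2 ∧
        d.toNat + g.toNat + i.toNat + j.toNat = 2 then
      75000 else 0) +
      (symmFlagForm (h, i, j) (b, c, d) (e, f, g) +
        symmFlagForm (f, g, j) (a, c, d) (e, h, i) +
        symmFlagForm (e, g, i) (a, b, d) (f, h, j) +
        symmFlagForm (e, f, h) (a, b, c) (g, i, j) +
        symmFlagForm (c, d, j) (a, f, g) (b, h, i) +
        symmFlagForm (b, d, i) (a, e, g) (c, h, j) +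
        symmFlagForm (b, c, h) (a, e, f) (d, i, j) +
        symmFlagForm (a, d, g) (b, e, i) (c, f, j) +
        symmFlagForm (a, c, f) (b, e, h) (d, g, j) +
        symmFlagForm (a, b, e) (c, f, h) (d, g, i)) ≤ (2880 : ℤ) := by
  decide +kernel

variable {V : Type*} (r : V → V → Bool)

/-- `flagForm` for the roots `x 2`, `x 3`, `x 4` and the remaining vertices `x 0`, `x 1`. -/
def rootedForm (x : Fin 5 → V) : ℤ :=
  flagForm (r (x 2) (x 3), r (x 2) (x 4), r (x 3) (x 4))
    (r (x 2) (x 0), r (x 3) (x 0), r (x 4) (x 0)) (r (x 2) (x 1), r (x 3) (x 1), r (x 4) (x 1))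

theorem sum_rootedForm_nonneg [Fintype V] : 0 ≤ ∑ x : Fin 5 → V, rootedForm r x := by
  have cons_sum {n : ℕ} (f : (Fin (n + 1) → V) → ℤ) :
      ∑ x, f x = ∑ x : Fin n → V, ∑ y, f (Fin.cons y x) := by
    rw [← (Fin.consEquiv fun _ => V).sum_comp, Fintype.sum_prod_type_right]
    rfl
  rw [cons_sum, cons_sum]
  refine sum_nonneg fun x _ => ?_
  rw [sum_comm]
  exact sum_sum_flagForm_nonneg (r (x 0) (x 1), r (x 0) (x 2), r (x 1) (x 2))
    fun y => (r (x 0) y, r (x 1) y, r (x 2) y)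

/-- Orderings of `Fin 5` representing all partitions of it into two vertices, two roots and a
distinguished root. -/
def rootings : List (Fin 5 → Fin 5) :=
  [![0, 1, 2, 3, 4], ![0, 1, 2, 4, 3], ![0, 1, 3, 4, 2],
    ![0, 2, 1, 3, 4], ![0, 2, 1, 4, 3], ![0, 2, 3, 4, 1],
    ![0, 3, 1, 2, 4], ![0, 3, 1, 4, 2], ![0, 3, 2, 4, 1],
    ![0, 4, 1, 2, 3], ![0, 4, 1, 3, 2], ![0, 4, 2, 3, 1],
    ![1, 2, 0, 3, 4], ![1, 2, 0, 4, 3], ![1, 2, 3, 4, 0],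
    ![1, 3, 0, 2, 4], ![1, 3, 0, 4, 2], ![1, 3, 2, 4, 0],
    ![1, 4, 0, 2, 3], ![1, 4, 0, 3, 2], ![1, 4, 2, 3, 0],
    ![2, 3, 0, 1, 4], ![2, 3, 0, 4, 1], ![2, 3, 1, 4, 0],
    ![2, 4, 0, 1, 3], ![2, 4, 0, 3, 1], ![2, 4, 1, 3, 0],
    ![3, 4, 0, 1, 2], ![3, 4, 0, 2, 1], ![3, 4, 1, 2, 0]]

theorem length_rootings : rootings.length = 30 := rfl

theorem bijective_of_mem_rootings : ∀ p ∈ rootings, p.Bijective := by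
  simp only [← Finite.injective_iff_bijective, ← List.forall_iff_forall_mem]
  decide +kernel

theorem sum_rootings_rootedForm [Fintype V] :
    ∑ x : Fin 5 → V, (rootings.map fun p => rootedForm r (x ∘ p)).sum =
      30 * ∑ x : Fin 5 → V, rootedForm r x := by
  have key (p : Fin 5 → Fin 5) (hp : p.Bijective) :
      ∑ x : Fin 5 → V, rootedForm r (x ∘ p) = ∑ x : Fin 5 → V, rootedForm r x :=
    ((Equiv.ofBijective p hp).symm.arrowCongr (Equiv.refl V)).sum_comp (rootedForm r)
  have hsum (l : List (Fin 5 → Fin 5)) (hl : ∀ p ∈ l, p.Bijective) :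
      ∑ x : Fin 5 → V, (l.map fun p => rootedForm r (x ∘ p)).sum =
        l.length * ∑ x : Fin 5 → V, rootedForm r x := by
    induction l with
    | nil => simp
    | cons p l ih =>
      simp only [List.map_cons, List.sum_cons, sum_add_distrib, List.length_cons]
      rw [key p (hl p (by simp)), ih fun q hq => hl q (by simp [hq])]
      push_cast
      ring
  rw [hsum rootings bijective_of_mem_rootings, length_rootings]
  norm_cast

theorem rootings_rootedForm_le (hs : ∀ v w, r v w = r w v) (hi : ∀ v, r v v = false)
    (ht : ∀ u v w, (r u v && r u w && r v w) = false) (x : Fin 5 → V) :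
    (if ∀ i, ∑ j, (r (x i) (x j)).toNat = 2 then 75000 else 0) +
      (rootings.map fun p => rootedForm r (x ∘ p)).sum ≤ 2880 := by
  have key := symmFlagForm_le (r (x 0) (x 1)) (r (x 0) (x 2)) (r (x 0) (x 3)) (r (x 0) (x 4))
    (r (x 1) (x 2)) (r (x 1) (x 3)) (r (x 1) (x 4)) (r (x 2) (x 3)) (r (x 2) (x 4))
    (r (x 3) (x 4)) (by simp only [ht, and_self])
  have h10 := hs (x 1) (x 0)
  have h20 := hs (x 2) (x 0)
  have h30 := hs (x 3) (x 0)
  have h40 := hs (x 4) (x 0)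
  have h21 := hs (x 2) (x 1)
  have h31 := hs (x 3) (x 1)
  have h41 := hs (x 4) (x 1)
  have h32 := hs (x 3) (x 2)
  have h42 := hs (x 4) (x 2)
  have h43 := hs (x 4) (x 3)
  convert key using 2
  · simp only [Fin.forall_fin_succ, Fin.sum_univ_five]
    simp [hi, h10, h20, h30, h40, h21, h31, h41, h32, h42, h43, add_assoc]
  · simp [rootings, rootedForm, symmFlagForm, h10, h20, h30, h40, h21, h31, h41, h32, h42, h43,
      add_assoc]

theorem card_twoRegular_le [Fintype V] (hs : ∀ v w, r v w = r w v) (hi : ∀ v, r v v = false)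
    (ht : ∀ u v w, (r u v && r u w && r v w) = false) :
    3125 * #{x : Fin 5 → V | ∀ i, ∑ j, (r (x i) (x j)).toNat = 2} ≤
      120 * Fintype.card V ^ 5 := by
  classical
  have h := sum_le_sum fun (x : Fin 5 → V) (_ : x ∈ univ) => rootings_rootedForm_le r hs hi ht x
  rw [sum_add_distrib, sum_rootings_rootedForm, ← sum_filter, sum_const, sum_const] at h
  have h0 := sum_rootedForm_nonneg r
  simp only [nsmul_eq_mul, card_univ, Fintype.card_fun, Fintype.card_fin, Nat.cast_pow] at h
  generalize #{x : Fin 5 → V | ∀ i, ∑ j, (r (x i) (x j)).toNat = 2} = N at h ⊢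
  zify
  linarith

end Pentagon

open Finset in
/-- Labelling each induced pentagon in all `120` ways gives distinct two-regular `5`-tuples. -/
theorem SimpleGraph.ncard_pentagon_mul_le {V : Type*} [Fintype V] (G : SimpleGraph V)
    [DecidableRel G.Adj] :
    {s : Finset V | s.card = 5 ∧ Nonempty (G.induce ↑s ≃g cycleGraph 5)}.ncard * 120 ≤
      #{x : Fin 5 → V | ∀ i, ∑ j, (decide (G.Adj (x i) (x j))).toNat = 2} := by
  classical
  set S := {s : Finset V | s.card = 5 ∧ Nonempty (G.induce ↑s ≃g cycleGraph 5)}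
  let e (s : S) : G.induce ↑s.1 ≃g cycleGraph 5 := s.2.2.some
  let F (q : S × Equiv.Perm (Fin 5)) (i : Fin 5) : V := (e q.1).symm (q.2 i)
  have hF q : ∀ i, ∑ j, (decide (G.Adj (F q i) (F q j))).toNat = 2 := fun i => by
    have hadj j : G.Adj (F q i) (F q j) ↔ (cycleGraph 5).Adj (q.2 i) (q.2 j) :=
      (e q.1).symm.map_adj_iff (v := q.2 i) (w := q.2 j)
    simp only [hadj]
    rw [Equiv.sum_comp q.2 fun j => (decide ((cycleGraph 5).Adj (q.2 i) j)).toNat]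
    generalize q.2 i = k
    revert k
    decide
  have hrange q : Set.range (F q) = (q.1 : Finset V) := by
    have : F q = Subtype.val ∘ (q.2.trans (e q.1).symm.toEquiv) := rfl
    rw [this, EquivLike.range_comp, Subtype.range_coe]
  have hinj : F.Injective := by
    rintro ⟨s, π⟩ ⟨t, ρ⟩ h
    obtain rfl : s = t := Subtype.ext (Finset.coe_injective (by
      rw [← hrange (s, π), ← hrange (t, ρ), h]))
    refine Prod.ext rfl (Equiv.ext fun i => ?_)
    exact (e s).symm.injective (Subtype.ext (congrFun h i))
  have hcard := card_le_card_of_injOn F (s := univ)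
    (t := {x : Fin 5 → V | ∀ i, ∑ j, (decide (G.Adj (x i) (x j))).toNat = 2})
    (fun q _ => by simpa using hF q) hinj.injOn
  rw [card_univ, Fintype.card_prod, Fintype.card_perm, Fintype.card_fin,
    ← Nat.card_eq_fintype_card, Nat.card_coe_set_eq] at hcard
  exact hcard

/-- Any triangle-free graph on `n` vertices contains at most `(n/5)⁵` cycles of
length 5, counted as 5-element vertex subsets inducing a copy of `C₅`. -/
theorem trianglefree_pentagon_count {V : Type*} [Fintype V] (G : SimpleGraph V)
    (hG : G.CliqueFree 3) :
    ({s : Finset V | s.card = 5 ∧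
        Nonempty (G.induce ↑s ≃g SimpleGraph.cycleGraph 5)}.ncard : ℝ) ≤
      ((Fintype.card V : ℝ) / 5) ^ 5 := by
  classical
  have hcount := G.ncard_pentagon_mul_le
  have hbound := Pentagon.card_twoRegular_le (fun v w => decide (G.Adj v w))
    (fun v w => by simp [G.adj_comm]) (fun v => by simp) fun u v w => by
      have : ¬(G.Adj u v ∧ G.Adj u w ∧ G.Adj v w) := fun h =>
        hG _ (SimpleGraph.is3Clique_triple_iff.mpr h)
      simpa [and_assoc] using this
  set c := {s : Finset V | s.card = 5 ∧
    Nonempty (G.induce ↑s ≃g SimpleGraph.cycleGraph 5)}.ncard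
  have h : (3125 * c : ℝ) ≤ (Fintype.card V : ℝ) ^ 5 := by
    exact_mod_cast (by omega : 3125 * c ≤ Fintype.card V ^ 5)
  rw [div_pow, le_div_iff₀ (by positivity)]
  linarith
end

section
/- Every triangle-free graph with maximum degree at most 3 on n vertices has an independent set of size at least 5n/14. -/
namespace SimpleGraph

open Finset

section Counting

variable {V : Type*} {G : SimpleGraph V}

lemma isIndepSet_union [DecidableEq V] {I J : Finset V} (hI : G.IsIndepSet (I : Set V))
    (hJ : G.IsIndepSet (J : Set V)) (h : ∀ a ∈ I, ∀ b ∈ J, ¬ G.Adj a b) :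
    G.IsIndepSet ((I ∪ J : Finset V) : Set V) := by
  intro a ha b hb hab hadj
  simp only [coe_union, Set.mem_union, mem_coe] at ha hb
  rcases ha with ha | ha <;> rcases hb with hb | hb
  · exact hI ha hb hab hadj
  · exact h a ha b hb hadj
  · exact h b hb a ha hadj.symm
  · exact hJ ha hb hab hadj

variable (G) [DecidableRel G.Adj]

/-- The number of pairs `(a, b)` of adjacent vertices with `a ∈ A` and `b ∈ B`. -/
def adjCount (A B : Finset V) : ℕ := ∑ a ∈ A, #{b ∈ B | G.Adj a b}

variable {G}

lemma adjCount_comm (A B : Finset V) : G.adjCount A B = G.adjCount B A := by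
  simp only [adjCount, card_filter]
  rw [sum_comm]
  simp only [G.adj_comm]

lemma adjCount_eq_zero_iff {A B : Finset V} :
    G.adjCount A B = 0 ↔ ∀ a ∈ A, ∀ b ∈ B, ¬ G.Adj a b := by
  simp [adjCount, filter_eq_empty_iff]

lemma adjCount_eq_card (A B : Finset V) :
    G.adjCount A B = #{p ∈ A ×ˢ B | G.Adj p.1 p.2} := by
  simp only [adjCount, card_filter, sum_product]

lemma card_filter_exists_adj_le (A B : Finset V) :
    #{a ∈ A | ∃ b ∈ B, G.Adj a b} ≤ G.adjCount A B := by
  rw [adjCount, card_filter]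
  refine sum_le_sum fun a _ ↦ ?_
  split_ifs with h
  · exact card_pos.2 (by simpa [Finset.Nonempty] using h)
  · exact Nat.zero_le _

lemma adjCount_map {W : Type*} {H : SimpleGraph W} [DecidableRel H.Adj]
    (φ : H ↪g G) (A B : Finset W) :
    G.adjCount (A.map φ.toEmbedding) (B.map φ.toEmbedding) = H.adjCount A B := by
  simp [adjCount, filter_map]

lemma adjCount_singleton_left (a : V) (C : Finset V) :
    G.adjCount {a} C = #{b ∈ C | G.Adj a b} := sum_singleton _ _

lemma card_filter_adj_map {n : ℕ} {H : SimpleGraph (Fin n)} (φ : H ↪g G) (q : V) :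
    #{b ∈ univ.map φ.toEmbedding | G.Adj q b} = #{i | G.Adj q (φ i)} := by
  simp [filter_map]

variable (G) in
/-- `S` contains an independent set `I` avoiding `F`, of size at least
`(4 |S| - e(S) - k) / 7`. -/
def LargeAvoiding (S F : Finset V) (k : ℕ) : Prop :=
  ∃ I ⊆ S, Disjoint I F ∧ G.IsIndepSet (I : Set V) ∧
    8 * #S ≤ 14 * #I + G.adjCount S S + 2 * k

lemma LargeAvoiding.of_copy {n : ℕ} {H : SimpleGraph (Fin n)} [DecidableRel H.Adj] (φ : H ↪g G)
    {F : Finset V} (J : Finset (Fin n)) (hJF : ∀ j ∈ J, φ j ∉ F)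
    (hJ : ∀ a ∈ J, ∀ b ∈ J, ¬ H.Adj a b) {k : ℕ}
    (hk : 8 * n ≤ 14 * #J + H.adjCount univ univ + 2 * k) :
    G.LargeAvoiding (univ.map φ.toEmbedding) F k := by
  refine ⟨J.map φ.toEmbedding, map_subset_map.2 (subset_univ J), ?_, ?_, ?_⟩
  · rw [Finset.disjoint_left]
    simpa using hJF
  · rintro a ha b hb hab
    simp only [coe_map, Set.mem_image, mem_coe] at ha hb
    obtain ⟨i, hi, rfl⟩ := ha
    obtain ⟨j, hj, rfl⟩ := hb
    simpa using hJ i hi j hj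
  · rw [adjCount_map]
    simpa using hk

variable [DecidableEq V]

lemma adjCount_union_left {A B : Finset V} (h : Disjoint A B) (C : Finset V) :
    G.adjCount (A ∪ B) C = G.adjCount A C + G.adjCount B C := sum_union h

lemma adjCount_union_right {A B : Finset V} (h : Disjoint A B) (C : Finset V) :
    G.adjCount C (A ∪ B) = G.adjCount C A + G.adjCount C B := by
  simp only [adjCount_comm C, adjCount_union_left h]

lemma adjCount_union_self {A B : Finset V} (h : Disjoint A B) :
    G.adjCount (A ∪ B) (A ∪ B) = G.adjCount A A + G.adjCount B B + 2 * G.adjCount A B := by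
  rw [adjCount_union_left h, adjCount_union_right h, adjCount_union_right h, adjCount_comm B A]
  ring

lemma adjCount_insert_left {a : V} {A : Finset V} (h : a ∉ A) (C : Finset V) :
    G.adjCount (insert a A) C = #{b ∈ C | G.Adj a b} + G.adjCount A C := sum_insert h

lemma adjCount_add_sdiff_right {B C : Finset V} (h : B ⊆ C) (A : Finset V) :
    G.adjCount A B + G.adjCount A (C \ B) = G.adjCount A C := by
  rw [← adjCount_union_right disjoint_sdiff, union_sdiff_of_subset h]

lemma adjCount_add_sdiff_left {A C : Finset V} (h : A ⊆ C) (B : Finset V) :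
    G.adjCount A B + G.adjCount (C \ A) B = G.adjCount C B := by
  rw [← adjCount_union_left disjoint_sdiff, union_sdiff_of_subset h]

lemma LargeAvoiding.mono {S F F' : Finset V} {k : ℕ} (h : G.LargeAvoiding S F k)
    (hF : F' ∩ S ⊆ F) : G.LargeAvoiding S F' k := by
  obtain ⟨I, hI, hIF, hind, hc⟩ := h
  refine ⟨I, hI, Finset.disjoint_left.2 fun a ha ha' ↦ ?_, hind, hc⟩
  exact Finset.disjoint_left.1 hIF ha (hF (mem_inter.2 ⟨ha', hI ha⟩))

lemma LargeAvoiding.union {A B F F' F'' : Finset V} {k l m : ℕ} (hAB : Disjoint A B)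
    (hA : G.LargeAvoiding A F k) (hB : G.LargeAvoiding B F' l)
    (hadj : ∀ a ∈ A, a ∉ F → ∀ b ∈ B, b ∉ F' → ¬ G.Adj a b)
    (hF : F'' ∩ A ⊆ F) (hF' : F'' ∩ B ⊆ F') (hm : k + l ≤ m + G.adjCount A B) :
    G.LargeAvoiding (A ∪ B) F'' m := by
  obtain ⟨I, hI, hIF, hind, hc⟩ := hA.mono (F' := F'' ∪ F) fun a ha ↦ by
    grind
  obtain ⟨J, hJ, hJF, hind', hc'⟩ := hB.mono (F' := F'' ∪ F') fun a ha ↦ by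
    grind
  simp only [disjoint_union_right] at hIF hJF
  refine ⟨I ∪ J, union_subset_union hI hJ, disjoint_union_left.2 ⟨hIF.1, hJF.1⟩,
    isIndepSet_union hind hind' fun a ha b hb ↦ ?_, ?_⟩
  · exact hadj a (hI ha) (Finset.disjoint_left.1 hIF.2 ha) b (hJ hb)
      (Finset.disjoint_left.1 hJF.2 hb)
  · rw [card_union_of_disjoint hAB, card_union_of_disjoint (disjoint_of_subset_left hI
      (disjoint_of_subset_right hJ hAB)), adjCount_union_self hAB]
    omega

end Counting

/-- The graph obtained from `K₄` by subdividing each of two disjoint edges twice. -/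
def kFourStar : SimpleGraph (Fin 8) where
  Adj i j := (i, j) ∈ [((0 : Fin 8), (2 : Fin 8)), (0, 3), (1, 2), (1, 3), (0, 4), (4, 5), (5, 1),
      (2, 6), (6, 7), (7, 3)] ∨
    (j, i) ∈ [((0 : Fin 8), (2 : Fin 8)), (0, 3), (1, 2), (1, 3), (0, 4), (4, 5), (5, 1),
      (2, 6), (6, 7), (7, 3)]
  symm := ⟨fun _ _ h ↦ h.symm⟩
  loopless := ⟨by decide⟩

instance : DecidableRel kFourStar.Adj := fun _ _ ↦ inferInstanceAs (Decidable (_ ∨ _))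

lemma adjCount_cycleGraph_five : (cycleGraph 5).adjCount univ univ = 10 := by decide

lemma adjCount_kFourStar : kFourStar.adjCount univ univ = 20 := by decide +kernel

lemma exists_indep_cycleGraph_five (i j : Fin 5) : ∃ J ∈ powersetCard 2 univ,
    (∀ a ∈ J, ∀ b ∈ J, ¬ (cycleGraph 5).Adj a b) ∧ i ∉ J ∧ j ∉ J := by
  decide +revert +kernel

lemma exists_indep_kFourStar (i j : Fin 8) : ∃ J ∈ powersetCard 3 univ,
    (∀ a ∈ J, ∀ b ∈ J, ¬ kFourStar.Adj a b) ∧ i ∉ J ∧ j ∉ J := by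
  decide +revert +kernel

lemma exists_indep_kFourStar_of_four_le (i j k : Fin 8) (hi : 4 ≤ i) (hj : 4 ≤ j) (hk : 4 ≤ k) :
    ∃ J ∈ powersetCard 3 univ,
      (∀ a ∈ J, ∀ b ∈ J, ¬ kFourStar.Adj a b) ∧ i ∉ J ∧ j ∉ J ∧ k ∉ J := by
  decide +revert +kernel

/-- In a 5-cycle, three vertices that meet every pair of nonadjacent vertices are consecutive. -/
lemma exists_indep_cycleGraph_five_or (i j k : Fin 5) :
    (∃ J ∈ powersetCard 2 univ,
      (∀ a ∈ J, ∀ b ∈ J, ¬ (cycleGraph 5).Adj a b) ∧ i ∉ J ∧ j ∉ J ∧ k ∉ J) ∨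
    (cycleGraph 5).Adj i k ∨ i = k ∨
    (i = j + 1 ∧ k = j + 4) ∨ (i = j + 4 ∧ k = j + 1) := by
  decide +revert +kernel

lemma eq_of_forall_kFourStar_adj_iff (i j : Fin 8)
    (h : ∀ k, kFourStar.Adj i k ↔ kFourStar.Adj j k) : i = j := by
  decide +revert +kernel

lemma eq_of_forall_cycleGraph_five_adj_iff (i j : Fin 5)
    (h : ∀ k, (cycleGraph 5).Adj i k ↔ (cycleGraph 5).Adj j k) : i = j := by
  decide +revert +kernel

lemma card_neighbors_cycleGraph_five (i : Fin 5) : #{j | (cycleGraph 5).Adj i j} = 2 := by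
  decide +revert

lemma card_neighbors_kFourStar_of_lt_four (i : Fin 8) (hi : ¬ 4 ≤ i) :
    #{j | kFourStar.Adj i j} = 3 := by
  decide +revert

lemma card_le_two_of_indep_cycleGraph_five (J : Finset (Fin 5))
    (hJ : ∀ i ∈ J, ∀ j ∈ J, ¬ (cycleGraph 5).Adj i j) : #J ≤ 2 := by
  decide +revert +kernel

lemma card_le_two_of_indep_kFourStar (J : Finset (Fin 8)) (hJ4 : ∀ i ∈ J, 4 ≤ i)
    (hJ : ∀ i ∈ J, ∀ j ∈ J, ¬ kFourStar.Adj i j) : #J ≤ 2 := by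
  decide +revert +kernel

variable {V : Type*} {G : SimpleGraph V}

lemma exists_embedding_of_adj_iff {W : Type*} {H : SimpleGraph W}
    (hH : ∀ i j, (∀ k, H.Adj i k ↔ H.Adj j k) → i = j) (f : W → V)
    (hf : ∀ i j, G.Adj (f i) (f j) ↔ H.Adj i j) : ∃ φ : H ↪g G, ⇑φ = f :=
  ⟨⟨⟨f, fun i j hij ↦ hH i j fun k ↦ by rw [← hf, hij, hf]⟩, hf _ _⟩, rfl⟩

lemma exists_subset_pair_of_card_le_two {α : Type*} [DecidableEq α] [Nonempty α] {T : Finset α}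
    (hT : #T ≤ 2) : ∃ i j, T ⊆ {i, j} := by
  obtain ⟨U, hTU, hU⟩ : ∃ U : Finset α, T ⊆ U ∧ (#U = 1 ∨ #U = 2) := by
    rcases T.eq_empty_or_nonempty with rfl | hne
    · exact ⟨{Classical.arbitrary α}, by simp⟩
    · have := hne.card_pos
      exact ⟨T, Subset.rfl, by omega⟩
  rcases hU with hU | hU
  · obtain ⟨i, rfl⟩ := card_eq_one.1 hU
    exact ⟨i, i, by simpa using hTU⟩
  · obtain ⟨i, j, -, rfl⟩ := card_eq_two.1 hU
    exact ⟨i, j, hTU⟩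

variable (G) in
/-- The sets `A` and `B` are disjoint and `ab` is the only edge between them. -/
structure JoinedByEdge (A B : Finset V) (a b : V) : Prop where
  disjoint : Disjoint A B
  left_mem : a ∈ A
  right_mem : b ∈ B
  adj : G.Adj a b
  eq_of_adj : ∀ a' ∈ A, ∀ b' ∈ B, G.Adj a' b' → a' = a ∧ b' = b

lemma JoinedByEdge.symm {A B : Finset V} {a b : V} (h : G.JoinedByEdge A B a b) :
    G.JoinedByEdge B A b a :=
  ⟨h.disjoint.symm, h.right_mem, h.left_mem, h.adj.symm,
    fun b' hb' a' ha' hab ↦ (h.eq_of_adj a' ha' b' hb' hab.symm).symm⟩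

lemma JoinedByEdge.adjCount_eq [DecidableRel G.Adj] {A B : Finset V} {a b : V}
    (h : G.JoinedByEdge A B a b) :
    G.adjCount A B = 1 := by
  rw [adjCount_eq_card, card_eq_one]
  refine ⟨(a, b), ?_⟩
  ext ⟨a', b'⟩
  have := h.eq_of_adj a'
  have := h.left_mem
  have := h.right_mem
  have := h.adj
  simp only [mem_filter, mem_product, mem_singleton, Prod.mk.injEq]
  grind

lemma exists_joinedByEdge [DecidableRel G.Adj] {A B : Finset V} (hAB : Disjoint A B)
    (h : G.adjCount A B = 1) :
    ∃ a b, G.JoinedByEdge A B a b := by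
  rw [adjCount_eq_card, card_eq_one] at h
  obtain ⟨⟨a, b⟩, h⟩ := h
  simp only [Finset.ext_iff, mem_filter, mem_product, mem_singleton, Prod.forall,
    Prod.mk.injEq] at h
  have := (h a b).2 ⟨rfl, rfl⟩
  exact ⟨a, b, hAB, this.1.1, this.1.2, this.2, fun a' ha' b' hb' hab ↦
    (h a' b').1 ⟨⟨ha', hb'⟩, hab⟩⟩

variable [DecidableEq V]

variable (G) in
/-- The vertex sets of the difficult graphs of Heckman and Thomas: those which are obtained from
induced copies of `C₅` and `K₄*` by successively joining two of them by a single edge. -/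
inductive Difficult : Finset V → Prop
  | of_cycle (φ : cycleGraph 5 ↪g G) : Difficult (univ.map φ.toEmbedding)
  | of_kFourStar (φ : kFourStar ↪g G) : Difficult (univ.map φ.toEmbedding)
  | join {A B : Finset V} {a b : V} (hA : Difficult A) (hB : Difficult B)
      (h : G.JoinedByEdge A B a b) : Difficult (A ∪ B)

lemma card_filter_embedding_le {n : ℕ} {H : SimpleGraph (Fin n)} (φ : H ↪g G) (F : Finset V) :
    #{i | φ i ∈ F} ≤ #(F ∩ univ.map φ.toEmbedding) := by
  rw [← card_map φ.toEmbedding]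
  refine card_le_card fun v hv ↦ ?_
  simp only [mem_map, mem_filter, mem_univ, true_and, RelEmbedding.coe_toEmbedding] at hv
  obtain ⟨i, hi, rfl⟩ := hv
  exact mem_inter.2 ⟨hi, mem_map_of_mem _ (mem_univ i)⟩

lemma difficult_cycle_union {φ : cycleGraph 5 ↪g G} {x v y : V} (hxv : G.Adj x v)
    (hvy : G.Adj v y) (hxy : ¬ G.Adj x y) (j : Fin 5)
    (hx : ∀ i, G.Adj x (φ i) ↔ i = j + 1 ∨ i = j + 4) (hv : ∀ i, ¬ G.Adj v (φ i))
    (hy : ∀ i, G.Adj y (φ i) ↔ i = j) :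
    G.Difficult (univ.map φ.toEmbedding ∪ {x, v, y}) := by
  have : ∀ j a b : Fin 5, (cycleGraph 5).Adj (j + a) (j + b) ↔ (cycleGraph 5).Adj a b := by decide
  have hψ (a b : Fin 5) : G.Adj (φ (j + a)) (φ (j + b)) ↔ (cycleGraph 5).Adj a b := by
    rw [φ.map_adj_iff]
    exact this j a b
  have hx' (a : Fin 5) : G.Adj x (φ (j + a)) ↔ a = 1 ∨ a = 4 := by
    rw [hx, add_right_inj, add_right_inj]
  have hy' (a : Fin 5) : G.Adj y (φ (j + a)) ↔ a = 0 := by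
    rw [hy, add_eq_left]
  have hv' (a : Fin 5) : ¬ G.Adj v (φ (j + a)) := hv _
  have hrange (u : V) : (∃ a, φ a = u) ↔ ∃ a, φ (j + a) = u :=
    ⟨fun ⟨a, ha⟩ ↦ ⟨a - j, by rwa [add_sub_cancel]⟩, fun ⟨a, ha⟩ ↦ ⟨j + a, ha⟩⟩
  generalize hψφ : (fun a ↦ φ (j + a)) = ψ at *
  have e (a : Fin 5) : φ (j + a) = ψ a := congrFun hψφ a
  simp only [e] at hψ hx' hy' hv' hrange
  obtain ⟨χ, hχ⟩ := exists_embedding_of_adj_iff (G := G) eq_of_forall_kFourStar_adj_iff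
    ![x, ψ 0, ψ 1, ψ 4, v, y, ψ 2, ψ 3] (by
      have hxy' : ¬ G.Adj y x := fun h ↦ hxy h.symm
      have hx'' (a : Fin 5) := (G.adj_comm _ _).trans (hx' a)
      have hy'' (a : Fin 5) := (G.adj_comm _ _).trans (hy' a)
      have hv'' (a : Fin 5) : ¬ G.Adj (ψ a) v := fun h ↦ hv' a h.symm
      intro m n
      fin_cases m <;> fin_cases n <;>
      simp [hψ, hx', hx'', hy', hy'', hv', hv'', hxy, hxy', hxv, hvy, hxv.symm, hvy.symm] <;>
      decide)
  convert Difficult.of_kFourStar χ using 1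
  ext u
  simp only [mem_union, mem_map, mem_univ, true_and, RelEmbedding.coe_toEmbedding, hrange, hχ,
    mem_insert, mem_singleton, Fin.exists_fin_succ]
  simp
  grind

lemma four_le_of_adj_kFourStar
    (hmax : ∀ (v : V) (T : Finset V), (∀ u ∈ T, G.Adj v u) → #T ≤ 3)
    (φ : kFourStar ↪g G) {z : V} (hz : z ∉ univ.map φ.toEmbedding) {i : Fin 8}
    (hzi : G.Adj z (φ i)) : 4 ≤ i := by
  by_contra hi
  have := hmax (φ i) (insert z (({j | kFourStar.Adj i j} : Finset (Fin 8)).map φ.toEmbedding))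
    (by simp [hzi.symm])
  rw [card_insert_of_notMem fun h ↦ hz (map_subset_map.2 (subset_univ _) h), card_map,
    card_neighbors_kFourStar_of_lt_four i hi] at this
  omega

variable [DecidableRel G.Adj]

lemma JoinedByEdge.largeAvoiding {A B F : Finset V} {a b : V} (h : G.JoinedByEdge A B a b)
    (hA : G.LargeAvoiding A F 1) (hB : G.LargeAvoiding B (insert b F) 1) :
    G.LargeAvoiding (A ∪ B) F 1 := by
  refine hA.union h.disjoint hB (fun a' ha' _ b' hb' hbF hab ↦ hbF ?_) inter_subset_left
    (inter_subset_left.trans (subset_insert b F)) (by rw [h.adjCount_eq])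
  rw [(h.eq_of_adj a' ha' b' hb' hab).2]
  exact mem_insert_self b F

lemma card_insert_inter_le (F A : Finset V) (a : V) : #(insert a F ∩ A) ≤ #(F ∩ A) + 1 := by
  by_cases ha : a ∈ A
  · rw [insert_inter_of_mem ha]
    exact card_insert_le _ _
  · rw [insert_inter_of_notMem ha]
    exact Nat.le_succ _

/-- If a set with a large independent set avoiding any two vertices is joined to another one,
one can avoid up to three vertices, provided that not all of them are in the same part. -/
lemma JoinedByEdge.largeAvoiding_of_card_le {A B F : Finset V} {a b : V}
    (h : G.JoinedByEdge A B a b)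
    (hA : ∀ F : Finset V, #(F ∩ A) ≤ 2 → G.LargeAvoiding A F 1)
    (hB : ∀ F : Finset V, #(F ∩ B) ≤ 2 → G.LargeAvoiding B F 1)
    (hFA : #(F ∩ A) ≤ 2) (hFB : #(F ∩ B) ≤ 2) (hF : #(F ∩ (A ∪ B)) ≤ 3) :
    G.LargeAvoiding (A ∪ B) F 1 := by
  rw [inter_union_distrib_left, card_union_of_disjoint
    (disjoint_of_subset_left inter_subset_right
      (disjoint_of_subset_right inter_subset_right h.disjoint))] at hF
  by_cases hF1 : #(F ∩ B) ≤ 1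
  · exact h.largeAvoiding (hA F hFA) (hB _ ((card_insert_inter_le F B b).trans (by omega)))
  · rw [union_comm]
    exact h.symm.largeAvoiding (hB F hFB) (hA _ ((card_insert_inter_le F A a).trans (by omega)))

lemma Difficult.largeAvoiding {D : Finset V} (hD : G.Difficult D) :
    ∀ F : Finset V, #(F ∩ D) ≤ 2 → G.LargeAvoiding D F 1 := by
  induction hD with
  | of_cycle φ =>
    intro F hF
    obtain ⟨i, j, hij⟩ := exists_subset_pair_of_card_le_two
      ((card_filter_embedding_le φ F).trans hF)
    obtain ⟨J, hJc, hJ, hi, hj⟩ := exists_indep_cycleGraph_five i j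
    rw [mem_powersetCard_univ] at hJc
    refine .of_copy φ J (fun a ha haF ↦ ?_) hJ (by rw [hJc, adjCount_cycleGraph_five])
    have : a ∈ ({i, j} : Finset _) := hij (by simpa using haF)
    grind
  | of_kFourStar φ =>
    intro F hF
    obtain ⟨i, j, hij⟩ := exists_subset_pair_of_card_le_two
      ((card_filter_embedding_le φ F).trans hF)
    obtain ⟨J, hJc, hJ, hi, hj⟩ := exists_indep_kFourStar i j
    rw [mem_powersetCard_univ] at hJc
    refine .of_copy φ J (fun a ha haF ↦ ?_) hJ (by rw [hJc, adjCount_kFourStar])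
    have : a ∈ ({i, j} : Finset _) := hij (by simpa using haF)
    grind
  | @join A B a b hA hB h ihA ihB =>
    intro F hF
    have hFA : #(F ∩ A) ≤ #(F ∩ (A ∪ B)) := card_le_card (by gcongr; exact subset_union_left)
    have hFB : #(F ∩ B) ≤ #(F ∩ (A ∪ B)) := card_le_card (by gcongr; exact subset_union_right)
    exact h.largeAvoiding_of_card_le ihA ihB (hFA.trans hF) (hFB.trans hF) (hF.trans (by norm_num))

lemma Difficult.adjCount_add_four_le {D : Finset V} (hD : G.Difficult D) :
    G.adjCount D D + 4 ≤ 3 * #D := by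
  induction hD with
  | of_cycle φ => rw [adjCount_map, adjCount_cycleGraph_five]; simp
  | of_kFourStar φ => rw [adjCount_map, adjCount_kFourStar]; simp
  | join hA hB h ihA ihB =>
    rw [adjCount_union_self h.disjoint, card_union_of_disjoint h.disjoint, h.adjCount_eq]
    omega

lemma Difficult.nonempty {D : Finset V} (hD : G.Difficult D) : D.Nonempty := by
  have := hD.adjCount_add_four_le
  exact card_pos.1 (by omega)

lemma Difficult.exists_kFourStar_or {D : Finset V} (hD : G.Difficult D) :
    (∃ φ : kFourStar ↪g G, univ.map φ.toEmbedding ⊆ D) ∨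
    (∃ φ : cycleGraph 5 ↪g G, univ.map φ.toEmbedding = D) ∨
    G.adjCount D D + 7 ≤ 3 * #D := by
  induction hD with
  | of_cycle φ => exact .inr (.inl ⟨φ, rfl⟩)
  | of_kFourStar φ => exact .inl ⟨φ, Subset.rfl⟩
  | @join A B a b hA hB h ihA ihB =>
    have key {A : Finset V} (h : (∃ φ : cycleGraph 5 ↪g G, univ.map φ.toEmbedding = A) ∨
        G.adjCount A A + 7 ≤ 3 * #A) : G.adjCount A A + 5 ≤ 3 * #A := by
      rcases h with ⟨φ, rfl⟩ | h
      · rw [adjCount_map, adjCount_cycleGraph_five]; simp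
      · omega
    rcases ihA with ⟨φ, hφ⟩ | ihA
    · exact .inl ⟨φ, hφ.trans subset_union_left⟩
    rcases ihB with ⟨φ, hφ⟩ | ihB
    · exact .inl ⟨φ, hφ.trans subset_union_right⟩
    refine .inr (.inr ?_)
    have := key ihA
    have := key ihB
    rw [adjCount_union_self h.disjoint, card_union_of_disjoint h.disjoint, h.adjCount_eq]
    omega

/-- Let `x v y` be an induced path with exactly three edges to a difficult set `D`, two of them at
`x` and one at `y`. Then either `D` has a large independent set avoiding the ends of these edges,
or adding the path to `D` results in a difficult set. -/
lemma Difficult.largeAvoiding_or {D : Finset V} (hD : G.Difficult D)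
    (htf : ∀ a b c, G.Adj a b → G.Adj b c → ¬ G.Adj a c)
    (hmax : ∀ (v : V) (T : Finset V), (∀ u ∈ T, G.Adj v u) → #T ≤ 3) {x v y d₁ d₂ d₃ : V}
    (hxv : G.Adj x v) (hvy : G.Adj v y) (hd : d₁ ≠ d₃) (hxD : x ∉ D) (hvD : v ∉ D) (hyD : y ∉ D)
    (hd₁ : d₁ ∈ D) (hd₂ : d₂ ∈ D) (hd₃ : d₃ ∈ D)
    (hx : ∀ u ∈ D, G.Adj x u ↔ u = d₁ ∨ u = d₃) (hv : ∀ u ∈ D, ¬ G.Adj v u)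
    (hy : ∀ u ∈ D, G.Adj y u ↔ u = d₂) :
    G.LargeAvoiding D {d₁, d₂, d₃} 1 ∨ G.Difficult (D ∪ {x, v, y}) := by
  have hF (A : Finset V) : #({d₁, d₂, d₃} ∩ A) ≤ 3 :=
    (card_le_card inter_subset_left).trans card_le_three
  have hxy : ¬ G.Adj x y := htf _ _ _ hxv hvy
  induction hD with
  | of_cycle φ =>
    simp only [mem_map, mem_univ, true_and, RelEmbedding.coe_toEmbedding] at hd₁ hd₂ hd₃
    obtain ⟨i, rfl⟩ := hd₁
    obtain ⟨j, rfl⟩ := hd₂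
    obtain ⟨k, rfl⟩ := hd₃
    have hmem (i : Fin 5) : φ i ∈ univ.map φ.toEmbedding := mem_map_of_mem _ (mem_univ i)
    have hx' (a : Fin 5) := hx _ (hmem a)
    have hv' (a : Fin 5) := hv _ (hmem a)
    have hy' (a : Fin 5) := hy _ (hmem a)
    simp only [EmbeddingLike.apply_eq_iff_eq] at hx' hy'
    rcases exists_indep_cycleGraph_five_or i j k with
      ⟨J, hJc, hJ, hi, hj, hk⟩ | hik | hik | ⟨rfl, rfl⟩ | ⟨rfl, rfl⟩
    · rw [mem_powersetCard_univ] at hJc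
      refine .inl (.of_copy φ J (fun a ha haF ↦ ?_) hJ (by rw [hJc, adjCount_cycleGraph_five]))
      simp only [mem_insert, mem_singleton, EmbeddingLike.apply_eq_iff_eq] at haF
      grind
    · exact absurd ((hx' k).2 (.inr rfl)) (htf _ _ _ ((hx' i).2 (.inl rfl)) (φ.map_adj_iff.2 hik))
    · exact absurd (congrArg φ hik) hd
    · exact .inr (difficult_cycle_union hxv hvy hxy j hx' hv' hy')
    · exact .inr (difficult_cycle_union hxv hvy hxy j (fun a ↦ (hx' a).trans or_comm) hv' hy')
  | of_kFourStar φ =>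
    have hmem (i : Fin 8) : φ i ∈ univ.map φ.toEmbedding := mem_map_of_mem _ (mem_univ i)
    simp only [mem_map, mem_univ, true_and, RelEmbedding.coe_toEmbedding] at hd₁ hd₂ hd₃
    obtain ⟨i, rfl⟩ := hd₁
    obtain ⟨j, rfl⟩ := hd₂
    obtain ⟨k, rfl⟩ := hd₃
    obtain ⟨J, hJc, hJ, hi, hj, hk⟩ := exists_indep_kFourStar_of_four_le i j k
      (four_le_of_adj_kFourStar hmax φ hxD ((hx _ (hmem i)).2 (.inl rfl)))
      (four_le_of_adj_kFourStar hmax φ hyD ((hy _ (hmem j)).2 rfl))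
      (four_le_of_adj_kFourStar hmax φ hxD ((hx _ (hmem k)).2 (.inr rfl)))
    rw [mem_powersetCard_univ] at hJc
    refine .inl (.of_copy φ J (fun a ha haF ↦ ?_) hJ (by rw [hJc, adjCount_kFourStar]))
    simp only [mem_insert, mem_singleton, EmbeddingLike.apply_eq_iff_eq] at haF
    grind
  | @join A B a b hA hB h ihA ihB =>
    simp only [mem_union, not_or] at hxD hvD hyD
    have key {A B : Finset V} {a b : V} (hA : G.Difficult A) (hB : G.Difficult B)
        (h : G.JoinedByEdge A B a b) (hxD : x ∉ A ∧ x ∉ B) (hvD : v ∉ A ∧ v ∉ B)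
        (hyD : y ∉ A ∧ y ∉ B) (hx : ∀ u ∈ A ∪ B, G.Adj x u ↔ u = d₁ ∨ u = d₃)
        (hv : ∀ u ∈ A ∪ B, ¬ G.Adj v u) (hy : ∀ u ∈ A ∪ B, G.Adj y u ↔ u = d₂)
        (hd₁ : d₁ ∈ A) (hd₂ : d₂ ∈ A) (hd₃ : d₃ ∈ A)
        (ih : G.LargeAvoiding A {d₁, d₂, d₃} 1 ∨ G.Difficult (A ∪ {x, v, y})) :
        G.LargeAvoiding (A ∪ B) {d₁, d₂, d₃} 1 ∨ G.Difficult (A ∪ B ∪ {x, v, y}) := by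
      have hAB := Finset.disjoint_left.1 h.disjoint
      rcases ih with ih | ih
      · refine .inl (h.largeAvoiding ih (hB.largeAvoiding _ ?_))
        refine (card_insert_inter_le _ _ _).trans ?_
        have : ({d₁, d₂, d₃} : Finset V) ∩ B = ∅ := by
          ext u
          simp only [mem_inter, mem_insert, mem_singleton, notMem_empty, iff_false, not_and]
          grind
        simp [this]
      · rw [union_right_comm]
        refine .inr (.join (a := a) (b := b) ih hB ⟨?_, ?_, h.right_mem, h.adj, ?_⟩)
        · rw [disjoint_union_left]
          simp [h.disjoint, hxD, hvD, hyD]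
        · exact mem_union_left _ h.left_mem
        · intro a' ha' b' hb' hab
          simp only [mem_union, mem_insert, mem_singleton] at ha'
          rcases ha' with ha' | rfl | rfl | rfl
          · exact h.eq_of_adj a' ha' b' hb' hab
          · grind
          · grind
          · grind
    by_cases hallA : d₁ ∈ A ∧ d₂ ∈ A ∧ d₃ ∈ A
    · obtain ⟨h₁, h₂, h₃⟩ := hallA
      refine key hA hB h hxD hvD hyD hx hv hy h₁ h₂ h₃ ?_
      exact ihA hxD.1 hvD.1 hyD.1 h₁ h₂ h₃ (fun u hu ↦ hx u (mem_union_left _ hu))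
        (fun u hu ↦ hv u (mem_union_left _ hu)) (fun u hu ↦ hy u (mem_union_left _ hu))
    by_cases hallB : d₁ ∈ B ∧ d₂ ∈ B ∧ d₃ ∈ B
    · obtain ⟨h₁, h₂, h₃⟩ := hallB
      rw [union_comm A B] at hx hv hy ⊢
      refine key hB hA h.symm hxD.symm hvD.symm hyD.symm hx hv hy h₁ h₂ h₃ ?_
      exact ihB hxD.2 hvD.2 hyD.2 h₁ h₂ h₃ (fun u hu ↦ hx u (mem_union_left _ hu))
        (fun u hu ↦ hv u (mem_union_left _ hu)) (fun u hu ↦ hy u (mem_union_left _ hu))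
    have card_le (A : Finset V) (hA : ¬ (d₁ ∈ A ∧ d₂ ∈ A ∧ d₃ ∈ A)) :
        #({d₁, d₂, d₃} ∩ A) ≤ 2 := by
      have : ({d₁, d₂, d₃} : Finset V) ∩ A ⊆ {d₁, d₂} ∨ ({d₁, d₂, d₃} : Finset V) ∩ A ⊆ {d₁, d₃} ∨
          ({d₁, d₂, d₃} : Finset V) ∩ A ⊆ {d₂, d₃} := by
        by_cases h₁ : d₁ ∈ A <;> by_cases h₂ : d₂ ∈ A <;> grind
      rcases this with h | h | h <;> exact (card_le_card h).trans card_le_two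
    exact .inl (h.largeAvoiding_of_card_le hA.largeAvoiding hB.largeAvoiding (card_le A hallA)
      (card_le B hallB) (hF _))

variable (G) in
/-- No difficult subset of `S` is a union of connected components of the graph induced on `S`. -/
def NoIsolatedDifficult (S : Finset V) : Prop :=
  ∀ D ⊆ S, G.Difficult D → G.adjCount D (S \ D) ≠ 0

lemma adjCount_sdiff_sdiff {D R S : Finset V} (hDR : D ⊆ R) (hRS : R ⊆ S) :
    G.adjCount D (S \ D) = G.adjCount D (R \ D) + G.adjCount D (S \ R) := by
  rw [← adjCount_union_right (disjoint_of_subset_left sdiff_subset disjoint_sdiff)]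
  congr 1
  grind

/-- Removing isolated difficult sets one by one. -/
lemma exists_largeAvoiding {S : Finset V} {c : ℕ}
    (ih : ∀ T ⊂ S, G.NoIsolatedDifficult T → G.LargeAvoiding T ∅ 0)
    (hcut : ∀ D ⊆ S, G.Difficult D → c ≤ G.adjCount D (S \ D)) (R : Finset V) (hR : R ⊂ S) :
    ∃ k, G.LargeAvoiding R ∅ k ∧ c * k ≤ G.adjCount R (S \ R) := by
  induction R using Finset.strongInduction with
  | H R ihR =>
    by_cases hiso : G.NoIsolatedDifficult R
    · exact ⟨0, ih R hR hiso, by simp⟩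
    simp only [NoIsolatedDifficult, not_forall, not_not] at hiso
    obtain ⟨D, hDR, hD, hiso⟩ := hiso
    have hss : R \ D ⊂ R := sdiff_ssubset hDR hD.nonempty
    obtain ⟨k, hk, hck⟩ := ihR (R \ D) hss (hss.trans hR)
    have h1 := hcut D (hDR.trans hR.subset) hD
    rw [adjCount_sdiff_sdiff hDR hR.subset, hiso] at h1
    rw [adjCount_sdiff_sdiff sdiff_subset hR.subset, Finset.sdiff_sdiff_eq_self hDR,
      adjCount_comm _ D, hiso] at hck
    refine ⟨k + 1, ?_, ?_⟩
    · have := hk.union sdiff_disjoint (hD.largeAvoiding ∅ (by simp)) (F'' := ∅) (m := k + 1)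
        (fun a ha _ b hb _ hab ↦ adjCount_eq_zero_iff.1 hiso b hb a ha hab.symm) (by simp)
        (by simp) (by omega)
      rwa [sdiff_union_of_subset hDR] at this
    · have := adjCount_add_sdiff_left (G := G) hDR (S \ R)
      rw [mul_add, mul_one]
      omega

/-- Deleting a set `X` containing the closed neighborhood of an independent set `I`. -/
lemma LargeAvoiding.of_sdiff {S X I : Finset V} {k : ℕ} (h : G.LargeAvoiding (S \ X) ∅ k)
    (hX : X ⊆ S) (hI : I ⊆ X) (hind : G.IsIndepSet (I : Set V))
    (hN : ∀ a ∈ I, ∀ b ∈ S, G.Adj a b → b ∈ X)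
    (hk : 8 * #X + 2 * k + G.adjCount X X ≤ 14 * #I + 2 * G.adjCount X S) :
    G.LargeAvoiding S ∅ 0 := by
  obtain ⟨J, hJ, -, hJind, hJc⟩ := h
  have h1 := adjCount_add_sdiff_right (G := G) hX X
  have h3 := adjCount_union_self (G := G) (disjoint_sdiff (s := X) (t := S))
  rw [union_sdiff_of_subset hX] at h3
  refine ⟨I ∪ J, union_subset (hI.trans hX) (hJ.trans sdiff_subset), by simp,
    isIndepSet_union hind hJind fun a ha b hb hab ↦ ?_, ?_⟩
  · have := mem_sdiff.1 (hJ hb)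
    exact this.2 (hN a ha b this.1 hab)
  · have h4 : Disjoint I J :=
      disjoint_of_subset_left hI (disjoint_of_subset_right hJ disjoint_sdiff)
    rw [card_union_of_disjoint h4]
    have := card_sdiff_add_card_eq_card hX
    omega

lemma largeAvoiding_of_deletion {S : Finset V} {c : ℕ}
    (ih : ∀ T ⊂ S, G.NoIsolatedDifficult T → G.LargeAvoiding T ∅ 0)
    (hcut : ∀ D ⊆ S, G.Difficult D → c ≤ G.adjCount D (S \ D)) {X I : Finset V} (hX : X ⊆ S)
    (hXne : X.Nonempty) (hI : I ⊆ X) (hind : G.IsIndepSet (I : Set V))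
    (hN : ∀ a ∈ I, ∀ b ∈ S, G.Adj a b → b ∈ X)
    (hk : ∀ k, c * k + G.adjCount X X ≤ G.adjCount X S →
      8 * #X + 2 * k + G.adjCount X X ≤ 14 * #I + 2 * G.adjCount X S) :
    G.LargeAvoiding S ∅ 0 := by
  obtain ⟨k, h, hck⟩ := exists_largeAvoiding ih hcut (S \ X) (sdiff_ssubset hX hXne)
  rw [Finset.sdiff_sdiff_eq_self hX, adjCount_comm] at hck
  have h1 := adjCount_add_sdiff_right (G := G) hX X
  exact h.of_sdiff hX hI hind hN (hk k (by omega))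

lemma three_le_adjCount {S : Finset V}
    (ih : ∀ T ⊂ S, G.NoIsolatedDifficult T → G.LargeAvoiding T ∅ 0)
    (hS : G.NoIsolatedDifficult S) (hn : ¬ G.LargeAvoiding S ∅ 0) :
    ∀ D ⊆ S, G.Difficult D → 3 ≤ G.adjCount D (S \ D) := by
  have key (D) (hDS : D ⊆ S) (hD : G.Difficult D) (k : ℕ) (hk : G.LargeAvoiding (S \ D) ∅ k)
      (hkD : k + 1 ≤ G.adjCount D (S \ D)) : 3 ≤ G.adjCount D (S \ D) := by
    by_contra! hlt
    refine hn ?_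
    have h1 := hD.largeAvoiding {a ∈ D | ∃ b ∈ S \ D, G.Adj a b}
      ((card_le_card inter_subset_left).trans
        ((card_filter_exists_adj_le D (S \ D)).trans (by omega)))
    have := h1.union disjoint_sdiff hk (F'' := ∅) (m := 0)
      (fun a ha haF b hb _ hab ↦ haF (mem_filter.2 ⟨ha, b, hb, hab⟩)) (by simp) (by simp)
      (by omega)
    rwa [union_sdiff_of_subset hDS] at this
  suffices ∀ n, ∀ D ⊆ S, G.Difficult D → G.adjCount D (S \ D) = n → 3 ≤ n from
    fun D hDS hD ↦ this _ D hDS hD rfl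
  intro n
  induction n with
  | zero => exact fun D hDS hD h ↦ absurd h (hS D hDS hD)
  | succ n ihn =>
    rintro D hDS hD hn'
    have hlt : S \ D ⊂ S := sdiff_ssubset hDS hD.nonempty
    by_cases hiso : G.NoIsolatedDifficult (S \ D)
    · rw [← hn']
      exact key D hDS hD 0 (ih _ hlt hiso) (by omega)
    simp only [NoIsolatedDifficult, not_forall, not_not] at hiso
    obtain ⟨E, hER, hE, hiso⟩ := hiso
    have hES := hER.trans sdiff_subset
    have hDE : Disjoint D E := disjoint_of_subset_right hER disjoint_sdiff
    have h1 := hS E hES hE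
    rw [adjCount_sdiff_sdiff hER sdiff_subset, hiso, zero_add, Finset.sdiff_sdiff_eq_self hDS,
      adjCount_comm] at h1
    have h2 := adjCount_add_sdiff_right (G := G) hER D
    by_cases h3 : G.adjCount D E = 1
    · obtain ⟨a, b, hab⟩ := exists_joinedByEdge hDE h3
      have h4 := ihn (D ∪ E) (union_subset hDS hES) (.join hD hE hab) (by
        rw [adjCount_union_left hDE, ← sup_eq_union, ← sdiff_sdiff_left, hiso]
        omega)
      omega
    · by_contra! h4
      have h5 : G.adjCount D ((S \ D) \ E) = 0 := by omega
      have h6 : G.NoIsolatedDifficult ((S \ D) \ E) := by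
        intro A hA hAd h0
        refine hS A (hA.trans (sdiff_subset.trans sdiff_subset)) hAd ?_
        rw [adjCount_sdiff_sdiff hA (sdiff_subset.trans sdiff_subset), h0, zero_add]
        refine adjCount_eq_zero_iff.2 fun a ha b hb hab ↦ ?_
        by_cases hbD : b ∈ D
        · exact adjCount_eq_zero_iff.1 h5 b hbD a (hA ha) hab.symm
        by_cases hbE : b ∈ E
        · exact adjCount_eq_zero_iff.1 hiso b hbE a (hA ha) hab.symm
        simp only [mem_sdiff, not_and, not_not] at hb
        exact hbE (hb.2 ⟨hb.1, hbD⟩)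
      have h7 := (ih _ ((sdiff_subset).trans_ssubset hlt) h6).union sdiff_disjoint
        (hE.largeAvoiding ∅ (by simp)) (F'' := ∅) (m := 1)
        (fun a ha _ b hb _ hab ↦ adjCount_eq_zero_iff.1 hiso b hb a ha hab.symm) (by simp)
        (by simp) (by omega)
      rw [sdiff_union_of_subset hER] at h7
      have := key D hDS hD 1 h7 (by omega)
      omega

lemma exists_filter_adj_eq_pair {S : Finset V} {u w : V} (hu : #{b ∈ S | G.Adj u b} = 2)
    (hw : w ∈ S) (huw : G.Adj u w) :
    ∃ z ∈ S, z ≠ w ∧ ∀ b ∈ S, G.Adj u b ↔ b = w ∨ b = z := by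
  have hmem : w ∈ ({b ∈ S | G.Adj u b} : Finset V) := mem_filter.2 ⟨hw, huw⟩
  obtain ⟨z, hz⟩ := card_eq_one.1 ((card_erase_of_mem hmem).trans (by rw [hu]))
  simp only [Finset.ext_iff, mem_erase, mem_filter, mem_singleton] at hz
  refine ⟨z, ((hz z).2 rfl).2.1, ((hz z).2 rfl).1, fun b hb ↦ ?_⟩
  have := hz b
  by_cases hbw : b = w
  · simp [hbw, huw]
  · grind

lemma NoIsolatedDifficult.of_adjCount_eq_zero {S T : Finset V} (hS : G.NoIsolatedDifficult S)
    (hT : T ⊆ S) (h : G.adjCount T (S \ T) = 0) : G.NoIsolatedDifficult T := by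
  intro A hA hAd h0
  refine hS A (hA.trans hT) hAd ?_
  rw [adjCount_sdiff_sdiff hA hT, h0, zero_add]
  rw [adjCount_eq_zero_iff] at h ⊢
  exact fun a ha ↦ h a (hA ha)

variable {S : Finset V}

lemma largeAvoiding_of_degree_le_one
    (ih : ∀ T ⊂ S, G.NoIsolatedDifficult T → G.LargeAvoiding T ∅ 0)
    (hcut : ∀ D ⊆ S, G.Difficult D → 3 ≤ G.adjCount D (S \ D))
    (hdeg : ∀ v ∈ S, #{b ∈ S | G.Adj v b} ≤ 3) {v : V} (hv : v ∈ S)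
    (h : #{b ∈ S | G.Adj v b} ≤ 1) : G.LargeAvoiding S ∅ 0 := by
  rcases Nat.le_one_iff_eq_zero_or_eq_one.1 h with h | h
  · refine largeAvoiding_of_deletion (X := {v}) (I := {v}) ih hcut (by simpa) (by simp) (by simp)
      (by simp) ?_ ?_
    · simp only [card_eq_zero, filter_eq_empty_iff] at h
      simpa using fun b hb hab ↦ absurd hab (h hb)
    · intro k
      have : G.adjCount {v} {v} = 0 := by simp [adjCount_eq_zero_iff]
      rw [adjCount_singleton_left v S, h, this, card_singleton]
      omega
  · obtain ⟨u, hu⟩ := card_eq_one.1 h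
    simp only [Finset.ext_iff, mem_filter, mem_singleton] at hu
    obtain ⟨huS, hvu⟩ := (hu u).2 rfl
    have huv := hvu.symm
    refine largeAvoiding_of_deletion (X := {v, u}) (I := {v}) ih hcut (by grind) (by simp)
      (by simp) (by simp) (by grind) fun k ↦ ?_
    have h1 : G.adjCount {v, u} S = 1 + #{b ∈ S | G.Adj u b} := by
      rw [adjCount_insert_left (by simpa using hvu.ne), adjCount_singleton_left, h]
    have h2 : G.adjCount {v, u} {v, u} = 2 := by
      rw [adjCount_insert_left (by simpa using hvu.ne), adjCount_singleton_left]
      simp [filter_insert, filter_singleton, hvu, huv]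
    have h3 := hdeg u huS
    rw [h1, h2, card_pair hvu.ne, card_singleton]
    omega

lemma largeAvoiding_of_degree_two_of_three
    (htf : ∀ a b c, G.Adj a b → G.Adj b c → ¬ G.Adj a c)
    (hmax : ∀ (v : V) (T : Finset V), (∀ u ∈ T, G.Adj v u) → #T ≤ 3)
    (ih : ∀ T ⊂ S, G.NoIsolatedDifficult T → G.LargeAvoiding T ∅ 0)
    (hS : G.NoIsolatedDifficult S)
    (hcut : ∀ D ⊆ S, G.Difficult D → 3 ≤ G.adjCount D (S \ D)) {v x y : V}
    (hv : v ∈ S) (hx : x ∈ S) (hy : y ∈ S) (hxy : x ≠ y)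
    (hvS : ∀ b ∈ S, G.Adj v b ↔ b = x ∨ b = y) (hdx : #{b ∈ S | G.Adj x b} = 3)
    (hdy : #{b ∈ S | G.Adj y b} = 2 ∨ #{b ∈ S | G.Adj y b} = 3) : G.LargeAvoiding S ∅ 0 := by
  have hvx : G.Adj v x := (hvS x hx).2 (.inl rfl)
  have hvy : G.Adj v y := (hvS y hy).2 (.inr rfl)
  have hxv := hvx.symm
  have hyv := hvy.symm
  have hxy' : ¬ G.Adj x y := htf _ _ _ hxv hvy
  have hyx' : ¬ G.Adj y x := fun h ↦ hxy' h.symm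
  have hnot : v ∉ ({x, y} : Finset V) ∧ x ∉ ({y} : Finset V) := by
    simp [hvx.ne, hvy.ne, hxy]
  have hsum (C : Finset V) : G.adjCount {v, x, y} C =
      #{b ∈ C | G.Adj v b} + #{b ∈ C | G.Adj x b} + #{b ∈ C | G.Adj y b} := by
    rw [adjCount_insert_left hnot.1, adjCount_insert_left hnot.2,
      adjCount_singleton_left, add_assoc]
  have hXS : {v, x, y} ⊆ S := by grind
  have hXc : #{v, x, y} = 3 := by
    rw [card_insert_of_notMem hnot.1, card_pair hxy]
  have hXX : G.adjCount {v, x, y} {v, x, y} = 4 := by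
    rw [hsum]
    simp [filter_insert, filter_singleton, hvx, hvy, hxv, hyv, hxy', hyx', card_pair hxy]
  have hdv : #{b ∈ S | G.Adj v b} = 2 := by
    rw [← card_pair hxy]
    congr 1
    grind
  have hN : ∀ a ∈ ({v} : Finset V), ∀ b ∈ S, G.Adj a b → b ∈ ({v, x, y} : Finset V) := by grind
  rcases hdy with hdy | hdy
  swap
  · refine largeAvoiding_of_deletion (X := {v, x, y}) (I := {v}) ih hcut hXS (by simp)
      (by simp) (by simp) hN fun k ↦ ?_
    rw [hXX, hsum, hdv, hdx, hdy, hXc, card_singleton]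
    omega
  have hXS7 : G.adjCount {v, x, y} S = 7 := by rw [hsum, hdv, hdx, hdy]
  by_cases hiso : G.NoIsolatedDifficult (S \ {v, x, y})
  · refine (ih _ (sdiff_ssubset hXS (by simp)) hiso).of_sdiff (I := {v}) hXS (by simp) (by simp)
      hN ?_
    rw [hXX, hXS7, hXc, card_singleton]
  simp only [NoIsolatedDifficult, not_forall, not_not] at hiso
  obtain ⟨D, hDR, hD, hiso⟩ := hiso
  have hDS : D ⊆ S := hDR.trans sdiff_subset
  have hcD := hcut D hDS hD
  rw [adjCount_sdiff_sdiff hDR sdiff_subset, hiso, Finset.sdiff_sdiff_eq_self hXS, zero_add,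
    adjCount_comm] at hcD
  have h1 := adjCount_add_sdiff_right (G := G) hXS {v, x, y}
  have h2 := adjCount_add_sdiff_right (G := G) hDR {v, x, y}
  have hvD : #{b ∈ D | G.Adj v b} = 0 := by
    rw [card_eq_zero, filter_eq_empty_iff]
    grind
  have hxD : #{b ∈ D | G.Adj x b} ≤ 2 := by
    have : ({b ∈ D | G.Adj x b} : Finset V) ⊂ {b ∈ S | G.Adj x b} :=
      (ssubset_iff_of_subset (filter_subset_filter _ hDS)).2 ⟨v, by grind, by grind⟩
    have := card_lt_card this
    omega
  have hyD : #{b ∈ D | G.Adj y b} ≤ 1 := by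
    have : ({b ∈ D | G.Adj y b} : Finset V) ⊂ {b ∈ S | G.Adj y b} :=
      (ssubset_iff_of_subset (filter_subset_filter _ hDS)).2 ⟨v, by grind, by grind⟩
    have := card_lt_card this
    omega
  have h3 := hsum D
  have hXT : G.adjCount {v, x, y} ((S \ {v, x, y}) \ D) = 0 := by omega
  have hXD3 : G.adjCount {v, x, y} D = 3 := by omega
  obtain ⟨d₁, d₃, hd, hxd⟩ := card_eq_two.1 (show #{b ∈ D | G.Adj x b} = 2 by omega)
  obtain ⟨d₂, hyd⟩ := card_eq_one.1 (show #{b ∈ D | G.Adj y b} = 1 by omega)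
  rw [card_eq_zero, filter_eq_empty_iff] at hvD
  simp only [Finset.ext_iff, mem_filter, mem_singleton, mem_insert] at hxd hyd
  rw [adjCount_eq_zero_iff] at hXT hiso
  have hdisj : Disjoint D {v, x, y} := disjoint_of_subset_left hDR sdiff_disjoint
  have hDXS : D ∪ {v, x, y} ⊆ S := union_subset hDS hXS
  have hTeq : S \ (D ∪ {v, x, y}) = (S \ {v, x, y}) \ D := by grind
  have hzero : G.adjCount (D ∪ {v, x, y}) (S \ (D ∪ {v, x, y})) = 0 := by
    rw [hTeq, adjCount_union_left hdisj, adjCount_eq_zero_iff.2 hiso, adjCount_eq_zero_iff.2 hXT]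
  have hT : G.LargeAvoiding (S \ (D ∪ {v, x, y})) ∅ 0 := by
    refine ih _ (sdiff_ssubset hDXS (by simp)) (hS.of_adjCount_eq_zero sdiff_subset ?_)
    rw [Finset.sdiff_sdiff_eq_self hDXS, adjCount_comm, hzero]
  have hset : ({x, v, y} : Finset V) = {v, x, y} := Finset.insert_comm x v {y}
  have hnotD : v ∉ D ∧ x ∉ D ∧ y ∉ D := by
    simpa using Finset.disjoint_right.1 hdisj
  rcases hD.largeAvoiding_or htf hmax hxv hvy hd hnotD.2.1 hnotD.1 hnotD.2.2
    ((hxd d₁).2 (.inl rfl)).1 ((hyd d₂).2 rfl).1 ((hxd d₃).2 (.inr rfl)).1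
    (fun u hu ↦ by simp [← hxd, hu]) (fun u hu ↦ hvD hu) (fun u hu ↦ by simp [← hyd, hu])
    with h | h
  · have hX : G.LargeAvoiding {v, x, y} {v} 0 := by
      refine ⟨{x, y}, by grind, by simp [hvx.ne, hvy.ne], ?_, ?_⟩
      · intro a ha b hb _
        simp only [coe_insert, coe_singleton, Set.mem_insert_iff, Set.mem_singleton_iff] at ha hb
        rcases ha with rfl | rfl <;> rcases hb with rfl | rfl <;> simp [hxy', hyx']
      · rw [hXX, hXc, card_pair hxy]
        omega
    have h4 := h.union hdisj hX (F'' := ∅) (m := 0) (by grind [SimpleGraph.adj_comm]) (by simp)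
      (by simp) (by rw [adjCount_comm, hXD3]; omega)
    have h5 := h4.union disjoint_sdiff hT (F'' := ∅) (m := 0)
      (fun a ha _ b hb _ ↦ adjCount_eq_zero_iff.1 hzero a ha b hb) (by simp) (by simp) (by omega)
    rwa [union_sdiff_of_subset hDXS] at h5
  · rw [hset] at h
    exact absurd hzero (hS _ hDXS h)

lemma largeAvoiding_of_degree_two
    (htf : ∀ a b c, G.Adj a b → G.Adj b c → ¬ G.Adj a c)
    (ih : ∀ T ⊂ S, G.NoIsolatedDifficult T → G.LargeAvoiding T ∅ 0)
    (hS : G.NoIsolatedDifficult S)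
    (hcut : ∀ D ⊆ S, G.Difficult D → 3 ≤ G.adjCount D (S \ D))
    (h2 : ∀ v ∈ S, ∀ x ∈ S, G.Adj v x → #{b ∈ S | G.Adj v b} = 2 → #{b ∈ S | G.Adj x b} = 2)
    {v : V} (hv : v ∈ S) (hdv : #{b ∈ S | G.Adj v b} = 2) : G.LargeAvoiding S ∅ 0 := by
  obtain ⟨x, hx⟩ : ({b ∈ S | G.Adj v b} : Finset V).Nonempty := card_pos.1 (by omega)
  obtain ⟨hx, hvx⟩ := mem_filter.1 hx
  obtain ⟨y, hy, hyx, hvS⟩ := exists_filter_adj_eq_pair hdv hx hvx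
  have hvy : G.Adj v y := (hvS y hy).2 (.inr rfl)
  have hdx := h2 v hv x hx hvx hdv
  have hdy := h2 v hv y hy hvy hdv
  obtain ⟨w, hw, hwv, hxS⟩ := exists_filter_adj_eq_pair hdx hv hvx.symm
  have hxw : G.Adj x w := (hxS w hw).2 (.inr rfl)
  have hdw := h2 x hx w hw hxw hdx
  obtain ⟨z, hz, hzx, hwS⟩ := exists_filter_adj_eq_pair hdw hx hxw.symm
  have hwz : G.Adj w z := (hwS z hz).2 (.inr rfl)
  have hdz := h2 w hw z hz hwz hdw
  have hxy : ¬ G.Adj x y := htf _ _ _ hvx.symm hvy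
  have hvw : ¬ G.Adj v w := htf _ _ _ hvx hxw
  have hxz : ¬ G.Adj x z := htf _ _ _ hxw hwz
  have hwy : w ≠ y := fun h ↦ hvw (h ▸ hvy)
  have hzv : z ≠ v := fun h ↦ hvw (h ▸ hwz.symm)
  have hsymm {a b : V} (h : ¬ G.Adj a b) : ¬ G.Adj b a := fun h' ↦ h h'.symm
  by_cases hzy : z = y
  · subst hzy
    have hn : v ∉ ({x, w, z} : Finset V) ∧ x ∉ ({w, z} : Finset V) ∧ w ∉ ({z} : Finset V) := by
      simp [hvx.ne, hvy.ne, hwv.symm, hxw.ne, hzx.symm, hwy]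
    have hsum (C : Finset V) : G.adjCount {v, x, w, z} C = #{b ∈ C | G.Adj v b} +
        (#{b ∈ C | G.Adj x b} + (#{b ∈ C | G.Adj w b} + #{b ∈ C | G.Adj z b})) := by
      rw [adjCount_insert_left hn.1, adjCount_insert_left hn.2.1, adjCount_insert_left hn.2.2,
        adjCount_singleton_left]
    refine largeAvoiding_of_deletion (X := {v, x, w, z}) (I := {v, w}) ih hcut (by grind)
      (by simp) (by grind) ?_ (by grind) fun k ↦ ?_
    · intro a ha b hb _
      simp only [coe_insert, coe_singleton, Set.mem_insert_iff, Set.mem_singleton_iff] at ha hb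
      rcases ha with rfl | rfl <;> rcases hb with rfl | rfl <;> simp [hvw, hsymm hvw]
    · have hXX : G.adjCount {v, x, w, z} {v, x, w, z} = 8 := by
        rw [hsum]
        simp [filter_insert, filter_singleton, hvx, hvx.symm, hvy, hvy.symm, hxw, hxw.symm,
          hwz, hwz.symm, hxy, hsymm hxy, hvw, hsymm hvw, hzx.symm, hwv.symm]
      rw [hXX, hsum, hdv, hdx, hdw, hdz, card_insert_of_notMem hn.1, card_insert_of_notMem hn.2.1,
        card_insert_of_notMem hn.2.2, card_singleton, card_pair hwv.symm]
      omega
  have hvz : ¬ G.Adj v z := fun h ↦ by grind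
  have hwy' : ¬ G.Adj w y := fun h ↦ by grind
  by_cases hzy' : G.Adj z y
  · obtain ⟨φ, hφ⟩ := exists_embedding_of_adj_iff (G := G) eq_of_forall_cycleGraph_five_adj_iff
      ![v, x, w, z, y] (by
        intro m n
        fin_cases m <;> fin_cases n <;>
        simp [hvx, hvx.symm, hvy, hvy.symm, hxw, hxw.symm, hwz, hwz.symm, hzy', hzy'.symm,
          hxy, hsymm hxy, hvw, hsymm hvw, hxz, hsymm hxz, hvz, hsymm hvz, hwy',
          hsymm hwy'] <;> decide)
    have hmem : ∀ u ∈ univ.map φ.toEmbedding, u ∈ S ∧ #{b ∈ S | G.Adj u b} = 2 := by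
      intro u hu
      simp only [mem_map, mem_univ, true_and, RelEmbedding.coe_toEmbedding, hφ,
        Fin.exists_fin_succ] at hu
      simp only [Matrix.cons_val_zero, Matrix.cons_val_succ, IsEmpty.exists_iff, or_false] at hu
      rcases hu with rfl | rfl | rfl | rfl | rfl
      exacts [⟨hv, hdv⟩, ⟨hx, hdx⟩, ⟨hw, hdw⟩, ⟨hz, hdz⟩, ⟨hy, hdy⟩]
    have hsub : univ.map φ.toEmbedding ⊆ S := fun u hu ↦ (hmem u hu).1
    refine absurd ?_ (hS _ hsub (.of_cycle φ))
    have h1 := adjCount_add_sdiff_right (G := G) hsub (univ.map φ.toEmbedding)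
    rw [adjCount_map, adjCount_cycleGraph_five] at h1
    have h3 : G.adjCount (univ.map φ.toEmbedding) S = 10 := by
      rw [adjCount, sum_const_nat fun u hu ↦ (hmem u hu).2]
      simp
    omega
  · have hn : z ∉ ({w, x, v, y} : Finset V) ∧ w ∉ ({x, v, y} : Finset V) ∧
        x ∉ ({v, y} : Finset V) ∧ v ∉ ({y} : Finset V) := by
      simp [hvx.ne', hvy.ne, hwv, hxw.ne', hzx, hwy, hwz.ne', hzv, hzy, hyx.symm]
    have hsum (C : Finset V) : G.adjCount {z, w, x, v, y} C = #{b ∈ C | G.Adj z b} +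
        (#{b ∈ C | G.Adj w b} + (#{b ∈ C | G.Adj x b} + (#{b ∈ C | G.Adj v b} +
          #{b ∈ C | G.Adj y b}))) := by
      rw [adjCount_insert_left hn.1, adjCount_insert_left hn.2.1, adjCount_insert_left hn.2.2.1,
        adjCount_insert_left hn.2.2.2, adjCount_singleton_left]
    refine largeAvoiding_of_deletion (X := {z, w, x, v, y}) (I := {w, v}) ih hcut (by grind)
      (by simp) (by grind) ?_ (by grind) fun k ↦ ?_
    · intro a ha b hb _
      simp only [coe_insert, coe_singleton, Set.mem_insert_iff, Set.mem_singleton_iff] at ha hb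
      rcases ha with rfl | rfl <;> rcases hb with rfl | rfl <;> simp [hvw, hsymm hvw]
    · have hXX : G.adjCount {z, w, x, v, y} {z, w, x, v, y} = 8 := by
        rw [hsum]
        simp [filter_insert, filter_singleton, hvx, hvx.symm, hvy, hvy.symm, hxw, hxw.symm,
          hwz, hwz.symm, hxy, hsymm hxy, hvw, hsymm hvw, hzx, hwv, hzy',
          hsymm hzy', hxz, hsymm hxz, hvz, hsymm hvz, hwy', hsymm hwy', hyx.symm]
      rw [hXX, hsum, hdv, hdx, hdw, hdz, hdy, card_insert_of_notMem hn.1,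
        card_insert_of_notMem hn.2.1, card_insert_of_notMem hn.2.2.1,
        card_insert_of_notMem hn.2.2.2, card_singleton, card_pair hwv]
      omega

lemma adjCount_insert_self {D : Finset V} {q : V} (hq : q ∉ D) :
    G.adjCount (insert q D) (insert q D) = G.adjCount D D + 2 * #{b ∈ D | G.Adj q b} := by
  have h : Disjoint {q} D := by simpa
  have h0 : G.adjCount {q} {q} = 0 := by simp [adjCount_eq_zero_iff]
  rw [insert_eq, adjCount_union_self h, adjCount_singleton_left q D, h0, zero_add]

lemma largeAvoiding_of_kFourStar
    (htf : ∀ a b c, G.Adj a b → G.Adj b c → ¬ G.Adj a c)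
    (hmax : ∀ (v : V) (T : Finset V), (∀ u ∈ T, G.Adj v u) → #T ≤ 3)
    (ih : ∀ T ⊂ S, G.NoIsolatedDifficult T → G.LargeAvoiding T ∅ 0)
    (hcut : ∀ D ⊆ S, G.Difficult D → 4 ≤ G.adjCount D (S \ D))
    (hdeg : ∀ v ∈ S, #{b ∈ S | G.Adj v b} = 3) (φ : kFourStar ↪g G)
    (hφ : univ.map φ.toEmbedding ⊆ S) : G.LargeAvoiding S ∅ 0 := by
  have hmem (i : Fin 8) : φ i ∈ univ.map φ.toEmbedding := mem_map_of_mem _ (mem_univ i)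
  have hlt : #{b ∈ univ.map φ.toEmbedding | G.Adj (φ 6) b} < #{b ∈ S | G.Adj (φ 6) b} := by
    rw [hdeg _ (hφ (hmem 6)), card_filter_adj_map]
    simp only [φ.map_adj_iff]
    decide
  obtain ⟨q, hq, hqD⟩ := exists_mem_notMem_of_card_lt_card hlt
  obtain ⟨hqS, hq6⟩ := mem_filter.1 hq
  replace hqD : q ∉ univ.map φ.toEmbedding := fun h ↦ hqD (mem_filter.2 ⟨h, hq6⟩)
  have hJ : #{i | G.Adj q (φ i)} ≤ 2 := by
    refine card_le_two_of_indep_kFourStar _ (fun i hi ↦ ?_) fun i hi j hj hij ↦ ?_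
    · exact four_le_of_adj_kFourStar hmax φ hqD (mem_filter.1 hi).2
    · exact htf _ _ _ (mem_filter.1 hi).2 (φ.map_adj_iff.2 hij) (mem_filter.1 hj).2
  have hJ' : 0 < #{i | G.Adj q (φ i)} := card_pos.2 ⟨6, by simpa using hq6.symm⟩
  have hXS : insert q (univ.map φ.toEmbedding) ⊆ S := insert_subset hqS hφ
  refine largeAvoiding_of_deletion (X := insert q (univ.map φ.toEmbedding))
    (I := ({0, 1, 6} : Finset (Fin 8)).map φ.toEmbedding) ih hcut hXS (by simp)
    ((map_subset_map.2 (subset_univ _)).trans (subset_insert _ _)) ?_ ?_ fun k ↦ ?_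
  · intro a ha b hb _
    simp only [coe_map, Set.mem_image, mem_coe] at ha hb
    obtain ⟨i, hi, rfl⟩ := ha
    obtain ⟨j, hj, rfl⟩ := hb
    have : ∀ i ∈ ({0, 1, 6} : Finset (Fin 8)), ∀ j ∈ ({0, 1, 6} : Finset (Fin 8)),
        ¬ kFourStar.Adj i j := by decide
    simpa using this i hi j hj
  · intro a ha b hb hab
    by_contra hbX
    simp only [mem_insert, not_or] at hbX
    simp only [mem_map, RelEmbedding.coe_toEmbedding] at ha
    obtain ⟨i, hi, rfl⟩ := ha
    by_cases hi4 : 4 ≤ i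
    · obtain rfl : i = 6 := by
        simp only [mem_insert, mem_singleton] at hi
        rcases hi with rfl | rfl | rfl
        · exact absurd hi4 (by decide)
        · exact absurd hi4 (by decide)
        · rfl
      have := hmax (φ 6) (insert b (insert q (({2, 7} : Finset (Fin 8)).map φ.toEmbedding))) (by
        have h2 : kFourStar.Adj 6 2 := by decide
        have h7 : kFourStar.Adj 6 7 := by decide
        simp [hab, hq6, h2, h7])
      rw [card_insert_of_notMem, card_insert_of_notMem, card_map] at this
      · exact absurd this (by decide)
      · exact fun h ↦ hqD (map_subset_map.2 (subset_univ _) h)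
      · simp only [mem_insert, not_or]
        exact ⟨hbX.1, fun h ↦ hbX.2 (map_subset_map.2 (subset_univ _) h)⟩
    · exact hi4 (four_le_of_adj_kFourStar hmax φ hbX.2 hab.symm)
  · rw [adjCount_insert_self hqD, card_filter_adj_map, adjCount_map, adjCount_kFourStar,
      adjCount, sum_const_nat fun u hu ↦ hdeg u (hXS hu), card_insert_of_notMem hqD, card_map,
      card_map, card_univ, Fintype.card_fin]
    simp
    omega

lemma largeAvoiding_of_cycleGraph_five
    (htf : ∀ a b c, G.Adj a b → G.Adj b c → ¬ G.Adj a c)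
    (hmax : ∀ (v : V) (T : Finset V), (∀ u ∈ T, G.Adj v u) → #T ≤ 3)
    (ih : ∀ T ⊂ S, G.NoIsolatedDifficult T → G.LargeAvoiding T ∅ 0)
    (hcut : ∀ D ⊆ S, G.Difficult D → 4 ≤ G.adjCount D (S \ D))
    (hdeg : ∀ v ∈ S, #{b ∈ S | G.Adj v b} = 3) (φ : cycleGraph 5 ↪g G)
    (hφ : univ.map φ.toEmbedding ⊆ S) {q : V} (hqS : q ∈ S) (hqD : q ∉ univ.map φ.toEmbedding)
    {i j : Fin 5} (hij : i ≠ j) (hqi : G.Adj q (φ i)) (hqj : G.Adj q (φ j)) :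
    G.LargeAvoiding S ∅ 0 := by
  have hij' : ¬ G.Adj (φ i) (φ j) := htf _ _ _ hqi.symm hqj
  have hJ : #{i | G.Adj q (φ i)} ≤ 2 :=
    card_le_two_of_indep_cycleGraph_five _ fun i hi j hj hij ↦
      htf _ _ _ (mem_filter.1 hi).2 (φ.map_adj_iff.2 hij) (mem_filter.1 hj).2
  have hJ' : 1 < #{i | G.Adj q (φ i)} := one_lt_card.2 ⟨i, by simpa, j, by simpa, hij⟩
  have hXS : insert q (univ.map φ.toEmbedding) ⊆ S := insert_subset hqS hφ
  refine largeAvoiding_of_deletion (X := insert q (univ.map φ.toEmbedding))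
    (I := ({i, j} : Finset (Fin 5)).map φ.toEmbedding) ih hcut hXS (by simp)
    ((map_subset_map.2 (subset_univ _)).trans (subset_insert _ _)) ?_ ?_ fun k ↦ ?_
  · intro a ha b hb _
    simp only [coe_map, coe_insert, coe_singleton, Set.image_pair, Set.mem_insert_iff,
      Set.mem_singleton_iff, RelEmbedding.coe_toEmbedding] at ha hb
    rcases ha with rfl | rfl <;> rcases hb with rfl | rfl <;> simp_all [SimpleGraph.adj_comm]
  · intro a ha b hb hab
    by_contra hbX
    simp only [mem_insert, not_or] at hbX
    obtain ⟨m, hm, rfl⟩ : ∃ m, G.Adj q (φ m) ∧ φ m = a := by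
      simp only [mem_map, mem_insert, mem_singleton, RelEmbedding.coe_toEmbedding] at ha
      obtain ⟨m, rfl | rfl, rfl⟩ := ha
      exacts [⟨_, hqi, rfl⟩, ⟨_, hqj, rfl⟩]
    have := hmax (φ m) (insert b (insert q
      (({j | (cycleGraph 5).Adj m j} : Finset (Fin 5)).map φ.toEmbedding))) (by
        intro u hu
        simp only [mem_insert, mem_map, mem_filter, mem_univ, true_and,
          RelEmbedding.coe_toEmbedding] at hu
        rcases hu with rfl | rfl | ⟨n, hn, rfl⟩
        exacts [hab, hm.symm, φ.map_adj_iff.2 hn])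
    rw [card_insert_of_notMem, card_insert_of_notMem, card_map,
      card_neighbors_cycleGraph_five] at this
    · omega
    · exact fun h ↦ hqD (map_subset_map.2 (subset_univ _) h)
    · simp only [mem_insert, not_or]
      exact ⟨hbX.1, fun h ↦ hbX.2 (map_subset_map.2 (subset_univ _) h)⟩
  · rw [adjCount_insert_self hqD, card_filter_adj_map, adjCount_map, adjCount_cycleGraph_five,
      adjCount, sum_const_nat fun u hu ↦ hdeg u (hXS hu), card_insert_of_notMem hqD, card_map,
      card_map, card_univ, Fintype.card_fin, card_pair hij]
    omega

lemma largeAvoiding_of_cubic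
    (htf : ∀ a b c, G.Adj a b → G.Adj b c → ¬ G.Adj a c)
    (hmax : ∀ (v : V) (T : Finset V), (∀ u ∈ T, G.Adj v u) → #T ≤ 3)
    (ih : ∀ T ⊂ S, G.NoIsolatedDifficult T → G.LargeAvoiding T ∅ 0)
    (hdeg : ∀ v ∈ S, #{b ∈ S | G.Adj v b} = 3) {v : V} (hv : v ∈ S) :
    G.LargeAvoiding S ∅ 0 := by
  have hsum {X : Finset V} (hX : X ⊆ S) : G.adjCount X S = #X * 3 :=
    sum_const_nat fun u hu ↦ hdeg u (hX hu)
  have hcut : ∀ D ⊆ S, G.Difficult D → 4 ≤ G.adjCount D (S \ D) := by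
    intro D hDS hD
    have h1 := adjCount_add_sdiff_right (G := G) hDS D
    have h2 := hD.adjCount_add_four_le
    rw [hsum hDS] at h1
    omega
  have hvN : v ∉ ({b ∈ S | G.Adj v b} : Finset V) := by simp
  have hXS : insert v {b ∈ S | G.Adj v b} ⊆ S := insert_subset hv (filter_subset _ _)
  have hXc : #(insert v {b ∈ S | G.Adj v b}) = 4 := by
    rw [card_insert_of_notMem hvN, hdeg v hv]
  have hNN : G.adjCount {b ∈ S | G.Adj v b} {b ∈ S | G.Adj v b} = 0 :=
    adjCount_eq_zero_iff.2 fun a ha b hb hab ↦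
      htf _ _ _ (mem_filter.1 ha).2 hab (mem_filter.1 hb).2
  have hXX : G.adjCount (insert v {b ∈ S | G.Adj v b}) (insert v {b ∈ S | G.Adj v b}) = 6 := by
    rw [adjCount_insert_self hvN, hNN, filter_filter]
    simp only [and_self]
    rw [hdeg v hv]
  by_cases hiso : G.NoIsolatedDifficult (S \ insert v {b ∈ S | G.Adj v b})
  · refine (ih _ (sdiff_ssubset hXS (by simp)) hiso).of_sdiff (I := {v}) hXS (by simp) (by simp)
      ?_ ?_
    · simp only [mem_singleton, forall_eq]
      exact fun b hb hab ↦ mem_insert_of_mem (mem_filter.2 ⟨hb, hab⟩)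
    · rw [hXX, hsum hXS, hXc, card_singleton]
  simp only [NoIsolatedDifficult, not_forall, not_not] at hiso
  obtain ⟨D, hDR, hD, hiso⟩ := hiso
  have hDS : D ⊆ S := hDR.trans sdiff_subset
  have h1 := adjCount_sdiff_sdiff (G := G) hDR sdiff_subset
  rw [hiso, Finset.sdiff_sdiff_eq_self hXS, zero_add, adjCount_comm D (insert _ _)] at h1
  have h2 := adjCount_add_sdiff_right (G := G) hXS (insert v {b ∈ S | G.Adj v b})
  have h3 := adjCount_add_sdiff_right (G := G) hDR (insert v {b ∈ S | G.Adj v b})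
  have h4 := adjCount_add_sdiff_right (G := G) hDS D
  rw [hsum hDS] at h4
  rw [hXX, hsum hXS, hXc] at h2
  rcases hD.exists_kFourStar_or with ⟨φ, hφ⟩ | ⟨φ, rfl⟩ | h
  · exact largeAvoiding_of_kFourStar htf hmax ih hcut hdeg φ (hφ.trans hDS)
  · have hmem (i : Fin 5) : φ i ∈ univ.map φ.toEmbedding := mem_map_of_mem _ (mem_univ i)
    have hex (m : Fin 5) : ∃ q ∈ ({b ∈ S | G.Adj v b} : Finset V),
        q ∉ univ.map φ.toEmbedding ∧ G.Adj q (φ m) := by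
      have hlt : #{b ∈ univ.map φ.toEmbedding | G.Adj (φ m) b} < #{b ∈ S | G.Adj (φ m) b} := by
        rw [hdeg _ (hDS (hmem m)), card_filter_adj_map]
        simp only [φ.map_adj_iff]
        rw [card_neighbors_cycleGraph_five]
        omega
      obtain ⟨q, hq, hqD⟩ := exists_mem_notMem_of_card_lt_card hlt
      obtain ⟨hqS, hqm⟩ := mem_filter.1 hq
      replace hqD : q ∉ univ.map φ.toEmbedding := fun h ↦ hqD (mem_filter.2 ⟨h, hqm⟩)
      have hqX : q ∈ insert v ({b ∈ S | G.Adj v b} : Finset V) := by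
        by_contra hqX
        exact adjCount_eq_zero_iff.1 hiso _ (hmem m) q
          (mem_sdiff.2 ⟨mem_sdiff.2 ⟨hqS, hqX⟩, hqD⟩) hqm
      rcases mem_insert.1 hqX with rfl | hqN
      · exact absurd (mem_insert_of_mem (mem_filter.2 ⟨hDS (hmem m), hqm.symm⟩))
          (mem_sdiff.1 (hDR (hmem m))).2
      · exact ⟨q, hqN, hqD, hqm.symm⟩
    choose f hfN hfD hf using hex
    obtain ⟨i, -, j, -, hij, hfij⟩ := exists_ne_map_eq_of_card_lt_of_maps_to
      (s := univ) (t := {b ∈ S | G.Adj v b}) (f := f) (by rw [hdeg v hv]; decide)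
      (fun m _ ↦ hfN m)
    exact largeAvoiding_of_cycleGraph_five htf hmax ih hcut hdeg φ hDS
      (mem_filter.1 (hfN i)).1 (hfD i) hij (hf i) (hfij ▸ hf j)
  · omega

/-- Every finite set of vertices without isolated difficult subsets contains an independent set of
size at least `(4 |S| - e(S)) / 7`. -/
lemma NoIsolatedDifficult.largeAvoiding
    (htf : ∀ a b c, G.Adj a b → G.Adj b c → ¬ G.Adj a c)
    (hmax : ∀ (v : V) (T : Finset V), (∀ u ∈ T, G.Adj v u) → #T ≤ 3) (S : Finset V)
    (hS : G.NoIsolatedDifficult S) : G.LargeAvoiding S ∅ 0 := by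
  induction S using Finset.strongInduction with
  | H S ih =>
    by_contra hn
    have hcut := three_le_adjCount ih hS hn
    have hdeg (v) (_ : v ∈ S) : #{b ∈ S | G.Adj v b} ≤ 3 := hmax v _ (by simp)
    have hdeg2 (v) (hv : v ∈ S) : #{b ∈ S | G.Adj v b} = 2 ∨ #{b ∈ S | G.Adj v b} = 3 := by
      have := hdeg v hv
      by_contra! h
      exact hn (largeAvoiding_of_degree_le_one ih hcut hdeg hv (by omega))
    by_cases h2 : ∃ v ∈ S, #{b ∈ S | G.Adj v b} = 2
    · obtain ⟨v, hv, hdv⟩ := h2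
      refine hn (largeAvoiding_of_degree_two htf ih hS hcut (fun v hv x hx hvx hdv ↦ ?_) hv hdv)
      refine (hdeg2 x hx).resolve_right fun hdx ↦ hn ?_
      obtain ⟨y, hy, hyx, hvS⟩ := exists_filter_adj_eq_pair hdv hx hvx
      exact largeAvoiding_of_degree_two_of_three htf hmax ih hS hcut hv hx hy hyx.symm hvS hdx
        (hdeg2 y hy)
    · rcases S.eq_empty_or_nonempty with rfl | ⟨v, hv⟩
      · exact hn ⟨∅, by simp⟩
      · exact hn (largeAvoiding_of_cubic htf hmax ih
          (fun v hv ↦ (hdeg2 v hv).resolve_left fun h ↦ h2 ⟨v, hv, h⟩) hv)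

lemma exists_isIndepSet_five_mul_card_le
    (htf : ∀ a b c, G.Adj a b → G.Adj b c → ¬ G.Adj a c)
    (hmax : ∀ (v : V) (T : Finset V), (∀ u ∈ T, G.Adj v u) → #T ≤ 3) (S : Finset V) :
    ∃ I ⊆ S, G.IsIndepSet (I : Set V) ∧ 5 * #S ≤ 14 * #I := by
  induction S using Finset.strongInduction with
  | H S ih =>
    by_cases hS : G.NoIsolatedDifficult S
    · obtain ⟨I, hI, -, hind, hc⟩ := hS.largeAvoiding htf hmax
      have : G.adjCount S S ≤ #S * 3 := sum_le_card_nsmul _ _ _ fun v _ ↦ hmax v _ (by simp)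
      exact ⟨I, hI, hind, by omega⟩
    simp only [NoIsolatedDifficult, not_forall, not_not] at hS
    obtain ⟨D, hDS, hD, hiso⟩ := hS
    obtain ⟨I, hI, hIind, hIc⟩ := ih _ (sdiff_ssubset hDS hD.nonempty)
    obtain ⟨J, hJ, -, hJind, hJc⟩ := hD.largeAvoiding ∅ (by simp)
    have h1 := hD.adjCount_add_four_le
    have h2 := card_sdiff_add_card_eq_card hDS
    refine ⟨J ∪ I, union_subset (hJ.trans hDS) (hI.trans sdiff_subset),
      isIndepSet_union hJind hIind fun a ha b hb ↦
        adjCount_eq_zero_iff.1 hiso a (hJ ha) b (hI hb), ?_⟩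
    rw [card_union_of_disjoint (disjoint_of_subset_left hJ
      (disjoint_of_subset_right hI disjoint_sdiff))]
    omega

end SimpleGraph

/-- Staton's theorem: every triangle-free graph on `n` vertices with maximum degree at
most 3 has an independent set of size at least `5n/14`. -/
theorem staton {V : Type*} [Fintype V] (G : SimpleGraph V) [DecidableRel G.Adj]
    (htf : G.CliqueFree 3) (hdeg : ∀ v, G.degree v ≤ 3) :
    ∃ s : Finset V, (↑s : Set V).Pairwise (fun a b => ¬ G.Adj a b) ∧
      (5 * (Fintype.card V : ℝ)) / 14 ≤ s.card := by
  classical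
  obtain ⟨I, -, hind, hc⟩ := G.exists_isIndepSet_five_mul_card_le
    (fun a b c hab hbc hac ↦ htf {a, b, c} (SimpleGraph.is3Clique_triple_iff.2 ⟨hab, hac, hbc⟩))
    (fun v T hT ↦ (Finset.card_le_card fun u hu ↦ (G.mem_neighborFinset v u).2 (hT u hu)).trans
      (hdeg v)) Finset.univ
  refine ⟨I, hind, ?_⟩
  rw [div_le_iff₀ (by norm_num), mul_comm (I.card : ℝ)]
  exact_mod_cast hc
end

section
/- There exists a triangle-free graph of maximum degree 5 on 28 vertices whose independence number is exactly 8, so the minimum independence ratio i(5) for triangle-free graphs of maximum degree at most 5 satisfies i(5) ≤ 8/28 = 2/7. -/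
/-- `s` is an independent set of `G`: pairwise non-adjacent vertices. -/
def IsIndepSet {V : Type*} (G : SimpleGraph V) (s : Set V) : Prop :=
  s.Pairwise fun a b => ¬ G.Adj a b

/-- The independence number of a graph on a finite vertex type. -/
noncomputable def indepNum {V : Type*} (G : SimpleGraph V) : ℕ :=
  sSup {k | ∃ s : Finset V, IsIndepSet G ↑s ∧ s.card = k}

/-- The neighbourhood of the vertex `n` of the witness graph, as a bit mask. The vertices
`0, …, 13` and `14, …, 27` form two copies of `ℤ/14`; antipodal points of each copy are joined,
and `x` in the first copy is joined to `x`, `x + 8`, `x + 9`, `x + 12` in the second. -/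
def nbrMask (n : ℕ) : ℕ :=
  if n < 14 then
    2 ^ ((n + 7) % 14) + 2 ^ (14 + n % 14) + 2 ^ (14 + (n + 8) % 14) + 2 ^ (14 + (n + 9) % 14) +
      2 ^ (14 + (n + 12) % 14)
  else
    2 ^ (14 + (n + 7) % 14) + 2 ^ (n % 14) + 2 ^ ((n + 6) % 14) + 2 ^ ((n + 5) % 14) +
      2 ^ ((n + 2) % 14)

/-- The witness graph: triangle-free, 5-regular, with 28 vertices and independence number 8. -/
def bicirculant : SimpleGraph (Fin 28) where
  Adj v w := (nbrMask v).testBit w = true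
  symm := ⟨by decide +kernel⟩
  loopless := ⟨by decide +kernel⟩

instance : DecidableRel bicirculant.Adj :=
  fun v w => inferInstanceAs (Decidable ((nbrMask v).testBit w = true))

/-- Backtracking search verifying that no `k` vertices below `n`, all outside the bit mask `m`,
are independent in the graph with neighbourhood masks `nbr`. -/
def noIndep (nbr : ℕ → ℕ) : ℕ → ℕ → ℕ → Bool
  | _, 0, _ => false
  | 0, _ + 1, _ => true
  | n + 1, k + 1, m =>
    Nat.ble (n + 1) k ||
      (noIndep nbr n (k + 1) m && (m.testBit n || noIndep nbr n k (m ||| nbr n)))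

theorem card_ne_of_noIndep {nbr : ℕ → ℕ} {n k m : ℕ} (h : noIndep nbr n k m = true)
    {s : Finset ℕ} (hs : s ⊆ Finset.range n) (hm : ∀ a ∈ s, m.testBit a = false)
    (hind : ∀ a ∈ s, ∀ b ∈ s, (nbr a).testBit b = false) : s.card ≠ k := by
  induction n generalizing k m s with
  | zero =>
    cases k with
    | zero => simp [noIndep] at h
    | succ k => simp [Finset.subset_empty.mp hs]
  | succ n ih =>
    cases k with
    | zero => simp [noIndep] at h
    | succ k =>
      simp only [noIndep, Bool.or_eq_true, Bool.and_eq_true, Nat.ble_eq] at h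
      rcases h with h | ⟨h₁, h₂⟩
      · have := Finset.card_le_card hs
        rw [Finset.card_range] at this
        omega
      by_cases hn : n ∈ s
      · have h₃ := h₂.resolve_left (by simp [hm n hn])
        have hsub : s.erase n ⊆ Finset.range n := by
          intro a ha
          have ha' := Finset.mem_range.mp (hs (Finset.mem_of_mem_erase ha))
          have := Finset.ne_of_mem_erase ha
          exact Finset.mem_range.mpr (by omega)
        have := ih h₃ hsub
          (fun a ha => by
            have ha' := Finset.mem_of_mem_erase ha
            simp [Nat.testBit_or, hm a ha', hind n hn a ha'])
          (fun a ha b hb => hind a (Finset.mem_of_mem_erase ha) b (Finset.mem_of_mem_erase hb))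
        rw [Finset.card_erase_of_mem hn] at this
        omega
      · refine ih h₁ (fun a ha => ?_) hm hind
        have ha' := Finset.mem_range.mp (hs ha)
        have : a ≠ n := fun e => hn (e ▸ ha)
        exact Finset.mem_range.mpr (by omega)

theorem noIndep_nbrMask : noIndep nbrMask 28 9 0 = true := by
  decide +kernel

theorem IsIndepSet.mono {V : Type*} {G : SimpleGraph V} {s t : Set V} (h : IsIndepSet G t)
    (hst : s ⊆ t) : IsIndepSet G s :=
  Set.Pairwise.mono hst h

theorem card_le_of_isIndepSet_bicirculant {s : Finset (Fin 28)}
    (hs : IsIndepSet bicirculant (s : Set (Fin 28))) : s.card ≤ 8 := by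
  by_contra! hcard
  obtain ⟨t, hts, ht⟩ := Finset.exists_subset_card_eq (show 9 ≤ s.card from hcard)
  have hind := hs.mono (Finset.coe_subset.mpr hts)
  refine card_ne_of_noIndep noIndep_nbrMask (s := t.map Fin.valEmbedding) ?_ (by simp) ?_
    (by rw [Finset.card_map, ht])
  · intro a ha
    obtain ⟨v, -, rfl⟩ := Finset.mem_map.mp ha
    exact Finset.mem_range.mpr v.isLt
  · intro a ha b hb
    obtain ⟨v, hv, rfl⟩ := Finset.mem_map.mp ha
    obtain ⟨w, hw, rfl⟩ := Finset.mem_map.mp hb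
    refine Bool.eq_false_iff.mpr fun hvw => ?_
    have hadj : bicirculant.Adj v w := hvw
    exact hind hv hw hadj.ne hadj

theorem indepNum_bicirculant : indepNum bicirculant = 8 := by
  refine IsGreatest.csSup_eq ⟨⟨{0, 1, 2, 3, 4, 5, 6, 21}, ?_, rfl⟩, ?_⟩
  · have h : ∀ a ∈ ({0, 1, 2, 3, 4, 5, 6, 21} : Finset (Fin 28)), ∀ b ∈ ({0, 1, 2, 3, 4, 5, 6, 21} : Finset (Fin 28)),
        ¬ bicirculant.Adj a b := by decide +kernel
    exact fun a ha b hb _ => h a ha b hb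
  · rintro _ ⟨s, hs, rfl⟩
    exact card_le_of_isIndepSet_bicirculant hs

theorem cliqueFree_bicirculant : bicirculant.CliqueFree 3 := by
  have h : ∀ a b, bicirculant.Adj a b → ∀ c, bicirculant.Adj a c → ¬ bicirculant.Adj b c := by
    decide +kernel
  intro s hs
  obtain ⟨a, b, c, hab, hac, hbc, -⟩ := SimpleGraph.is3Clique_iff.mp hs
  exact h a b hab c hac hbc

theorem ncard_neighborSet_bicirculant (v : Fin 28) :
    (bicirculant.neighborSet v).ncard = 5 := by
  rw [Set.ncard_eq_toFinset_card']
  revert v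
  decide +kernel

/-- There is a triangle-free graph of maximum degree 5 on 28 vertices with independence
number exactly 8; hence the minimum independence ratio `i(5)` over triangle-free graphs
of maximum degree at most 5 satisfies `i(5) ≤ 8/28 = 2/7`. -/
theorem i5_le_two_sevenths :
    (∃ G : SimpleGraph (Fin 28),
      G.CliqueFree 3 ∧
      (∀ v, (G.neighborSet v).ncard ≤ 5) ∧ (∃ v, (G.neighborSet v).ncard = 5) ∧
      indepNum G = 8) ∧
    sInf {r : ℝ | ∃ (n : ℕ) (G : SimpleGraph (Fin n)), 0 < n ∧
        G.CliqueFree 3 ∧ (∀ v, (G.neighborSet v).ncard ≤ 5) ∧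
        r = (indepNum G : ℝ) / n} ≤ 8 / 28 := by
  have hdeg v := (ncard_neighborSet_bicirculant v).le
  refine ⟨⟨bicirculant, cliqueFree_bicirculant, hdeg, ⟨0, ncard_neighborSet_bicirculant 0⟩,
    indepNum_bicirculant⟩, ?_⟩
  refine csInf_le ⟨0, ?_⟩ ⟨28, bicirculant, by norm_num, cliqueFree_bicirculant, hdeg, ?_⟩
  · rintro _ ⟨n, G, -, -, -, rfl⟩
    positivity
  · rw [indepNum_bicirculant]
    norm_num
end

section
/- If G is a repeatable graph with respect to δ and χ with layers N₀, N₁, …, N_d, then c_{δ,χ} ≥ (d−1)/|N₀ ∪ N₁ ∪ ⋯ ∪ N_{d−2}|, i.e., there exist connected graphs of arbitrarily large order n with minimum degree δ and chromatic number at most χ whose diameter is at least ((d−1)/|N₀ ∪ ⋯ ∪ N_{d−2}|)·n − O(1). -/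
/-- `layer G N₀ i` is the set of vertices at distance exactly `i` from the set `N₀`. -/
def layer {V : Type*} (G : SimpleGraph V) (N₀ : Set V) (i : ℕ) : Set V :=
  {v | (∃ u ∈ N₀, G.dist u v = i) ∧ ∀ u ∈ N₀, i ≤ G.dist u v}

section

open Finset

theorem pair_bound_aux {K : ℕ} {x y : Fin K → ℕ} {A B q r q' r' : ℕ} (hAB : A ≤ B)
    (hx : ∀ j, 0 < x j → x j + y j ≤ A) (hy : ∀ j, 0 < y j → x j + y j ≤ B)
    (hsx : ∑ j, x j = q * A + r) (hsy : ∑ j, y j = q' * B + r') (hr : 0 < r) :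
    q + q' + 1 ≤ K ∧ (q + q' + 1 = K → r + r' ≤ A) := by
  set T : Finset (Fin K) := univ.filter fun j => 0 < x j with hT
  have hsum_x : ∑ j ∈ T, x j = ∑ j, x j := by
    rw [hT, sum_filter]
    exact sum_congr rfl fun j _ => by split_ifs <;> omega
  have hqT : q < T.card := by
    have h : ∑ j ∈ T, x j ≤ T.card * A :=
      sum_le_card_nsmul T x A fun j hj => by have := hx j (by simpa [hT] using hj); omega
    by_contra! hle
    have := Nat.mul_le_mul_right A hle
    omega
  have hin : ∑ j ∈ T, (x j + y j) ≤ T.card * A :=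
    sum_le_card_nsmul T _ A fun j hj => hx j (by simpa [hT] using hj)
  have hout : ∑ j ∈ Tᶜ, (x j + y j) ≤ Tᶜ.card * B := by
    refine sum_le_card_nsmul Tᶜ _ B fun j hj => ?_
    have : x j = 0 := by simpa [hT] using hj
    rcases Nat.eq_zero_or_pos (y j) with h | h
    · omega
    · exact hy j h
  have htot := sum_add_sum_compl T fun j => x j + y j
  simp only [sum_add_distrib] at htot hin hout
  rw [hsx, hsy] at htot
  have hcard : T.card + Tᶜ.card = K := by simp
  obtain ⟨t, ht⟩ := Nat.exists_eq_add_of_lt hqT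
  rw [ht] at hin hcard
  have htA : t * A ≤ t * B := Nat.mul_le_mul_left t hAB
  have hmain : r + r' + q' * B ≤ A + (t + Tᶜ.card) * B := by
    have : (q + t + 1) * A = q * A + t * A + A := by ring
    have : (t + Tᶜ.card) * B = t * B + Tᶜ.card * B := by ring
    omega
  have hq' : q' ≤ t + Tᶜ.card := by
    by_contra! hlt
    have := Nat.mul_le_mul_right B hlt
    have : (t + Tᶜ.card).succ * B = (t + Tᶜ.card) * B + B := by rw [Nat.succ_mul]
    omega
  refine ⟨by omega, fun h => ?_⟩
  have : q' = t + Tᶜ.card := by omega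
  rw [← this] at hmain
  omega

/-- Two consecutive layers with color class sizes `x` and `y`: writing the layer sizes as
`q * A + r` and `q' * B + r'`, the two layers need at most `K` colors, one of them shared only if
the remainders fit together into a single color class. -/
theorem pair_bound {K : ℕ} {x y : Fin K → ℕ} {A B q r q' r' : ℕ}
    (hx : ∀ j, 0 < x j → x j + y j ≤ A) (hy : ∀ j, 0 < y j → x j + y j ≤ B)
    (hsx : ∑ j, x j = q * A + r) (hsy : ∑ j, y j = q' * B + r') (hr : 0 < r) (hr' : 0 < r') :
    q + q' + 1 ≤ K ∧ (q + q' + 1 = K → r + r' ≤ A ∧ r + r' ≤ B) := by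
  rcases le_total A B with hAB | hBA
  · have h := pair_bound_aux hAB hx hy hsx hsy hr
    exact ⟨h.1, fun hK => ⟨h.2 hK, (h.2 hK).trans hAB⟩⟩
  · have h := pair_bound_aux hBA (fun j hj => by rw [add_comm]; exact hy j hj)
      (fun j hj => by rw [add_comm]; exact hx j hj) hsy hsx hr'
    refine ⟨by omega, fun hK => ?_⟩
    have := h.2 (by omega)
    omega

/-- Three consecutive layers in which both pairs of neighboring layers use all `K` colors: the
three remainders fit together into a single color class. -/
theorem triple_bound {K : ℕ} {x y z : Fin K → ℕ} {A B C q₁ r₁ q₂ r₂ q₃ r₃ : ℕ}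
    (hx : ∀ j, 0 < x j → x j + y j ≤ A) (hy : ∀ j, 0 < y j → x j + y j + z j ≤ B)
    (hz : ∀ j, 0 < z j → y j + z j ≤ C)
    (hsx : ∑ j, x j = q₁ * A + r₁) (hsy : ∑ j, y j = q₂ * B + r₂)
    (hsz : ∑ j, z j = q₃ * C + r₃) (hr₁ : 0 < r₁) (hr₂ : 0 < r₂)
    (h₁₂ : q₁ + q₂ + 1 = K) (h₂₃ : q₂ + q₃ + 1 = K) : r₁ + r₂ + r₃ ≤ B := by
  obtain rfl : q₁ = q₃ := by omega
  have hxA : ∀ j, x j ≤ A := fun j => by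
    rcases Nat.eq_zero_or_pos (x j) with h | h
    · omega
    · have := hx j h; omega
  have hzC : ∀ j, z j ≤ C := fun j => by
    rcases Nat.eq_zero_or_pos (z j) with h | h
    · omega
    · have := hz j h; omega
  set T : Finset (Fin K) := univ.filter fun j => 0 < y j with hT
  set U : Finset (Fin K) := T.filter fun j => 0 < x j ∨ 0 < z j with hU
  have hsum_y : ∑ j ∈ T, y j = ∑ j, y j := by
    rw [hT, sum_filter]
    exact sum_congr rfl fun j _ => by split_ifs <;> omega
  have hqT : q₂ < T.card := by
    have h : ∑ j ∈ T, y j ≤ T.card * B :=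
      sum_le_card_nsmul T y B fun j hj => by have := hy j (by simpa [hT] using hj); omega
    by_contra! hle
    have := Nat.mul_le_mul_right B hle
    omega
  have hcard : T.card + Tᶜ.card = K := by simp
  obtain ⟨t, ht⟩ := Nat.exists_eq_add_of_lt hqT
  have hq : q₁ = Tᶜ.card + t := by omega
  have hTx : t * A + r₁ ≤ ∑ j ∈ T, x j := by
    have h₁ : ∑ j ∈ Tᶜ, x j ≤ Tᶜ.card * A := sum_le_card_nsmul _ x A fun j _ => hxA j
    have h₂ := sum_add_sum_compl T x
    rw [hq, add_mul] at hsx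
    omega
  have hTz : t * C + r₃ ≤ ∑ j ∈ T, z j := by
    have h₁ : ∑ j ∈ Tᶜ, z j ≤ Tᶜ.card * C := sum_le_card_nsmul _ z C fun j _ => hzC j
    have h₂ := sum_add_sum_compl T z
    rw [hq, add_mul] at hsz
    omega
  have htU : t < U.card := by
    have h₁ : ∑ j ∈ U, x j = ∑ j ∈ T, x j := by
      rw [hU, sum_filter]
      exact sum_congr rfl fun j _ => by split_ifs <;> omega
    have h₂ : ∑ j ∈ U, x j ≤ U.card * A := sum_le_card_nsmul _ x A fun j _ => hxA j
    by_contra! hle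
    have := Nat.mul_le_mul_right A hle
    omega
  obtain ⟨u, hu⟩ := Nat.exists_eq_add_of_lt htU
  have hUT : U ⊆ T := filter_subset _ _
  have hsplit := sum_sdiff (f := fun j => x j + y j + z j) hUT
  have hcardU := card_sdiff_add_card_eq_card hUT
  set D := min B (A + C) with hD
  have hsumU : ∑ j ∈ U, (x j + y j + z j) ≤ U.card * D := by
    refine sum_le_card_nsmul _ _ _ fun j hj => ?_
    simp only [hU, hT, mem_filter, mem_univ, true_and] at hj
    refine le_min (hy j hj.1) ?_
    have := hxA j
    have := hzC j
    rcases hj.2 with h | h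
    · have := hx j h; omega
    · have := hz j h; omega
  have hsumT : ∑ j ∈ T \ U, (x j + y j + z j) ≤ (T \ U).card * B :=
    sum_le_card_nsmul _ _ _ fun j hj => hy j (by
      have := (mem_sdiff.mp hj).1
      simpa [hT] using this)
  rw [sum_add_distrib, sum_add_distrib, sum_add_distrib] at hsplit
  have hDB : D ≤ B := min_le_left _ _
  have hDAC : D ≤ A + C := min_le_right _ _
  have e₁ : U.card * D = t * D + u * D + D := by rw [hu]; ring
  have e₂ := Nat.mul_le_mul_left t hDAC
  have e₃ := Nat.mul_le_mul_left u hDB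
  have e₄ : (T \ U).card * B + u * B = q₂ * B := by
    rw [← add_mul]
    congr 1
    omega
  have e₅ : t * (A + C) = t * A + t * C := by ring
  simp only [sum_add_distrib] at hsumU hsumT hsplit
  omega

theorem exists_seq_rel {α : ℕ → Type*} (a₀ : α 0) (R : ∀ i, α i → α (i + 1) → Prop)
    (h : ∀ i a, ∃ b, R i a b) : ∃ f : ∀ i, α i, ∀ i, R i (f i) (f (i + 1)) := by
  choose g hg using h
  exact ⟨fun i => Nat.rec a₀ g i, fun i => hg i _⟩

theorem exists_next_color_set {K q q' : ℕ} (hK : 2 ≤ K) (hq : q + q' + 1 ≤ K)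
    (C : Finset (Fin K)) (s : Fin K) (hC : C.card = q + 1) (hs : s ∈ C) :
    ∃ (C' : Finset (Fin K)) (s' : Fin K), C'.card = q' + 1 ∧ s' ∈ C' ∧
      (∀ j ∈ C, j ∈ C' → j = s ∧ j = s' ∧ q + q' + 1 = K) ∧ ∃ j ∈ C, ∃ k ∈ C', j ≠ k := by
  have hcompl : C.card + Cᶜ.card = K := by simp
  by_cases htight : q + q' + 1 = K
  · have hcard : (insert s Cᶜ).card = q' + 1 := by
      rw [card_insert_of_notMem (by simpa using hs)]
      omega
    refine ⟨insert s Cᶜ, s, hcard, mem_insert_self _ _, fun j hj hj' => ?_, ?_⟩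
    · have : j = s := by simpa [hj] using hj'
      exact ⟨this, this, htight⟩
    · by_cases h : 1 < C.card
      · obtain ⟨j, hj, hjs⟩ := exists_mem_ne h s
        exact ⟨j, hj, s, mem_insert_self _ _, hjs⟩
      · obtain ⟨k, hk, hks⟩ := exists_mem_ne (s := insert s Cᶜ) (by omega) s
        exact ⟨s, hs, k, hk, hks.symm⟩
  · obtain ⟨C', hC', hcard⟩ := exists_subset_card_eq (s := Cᶜ) (n := q' + 1) (by omega)
    obtain ⟨s', hs'⟩ := card_pos.mp (by omega : 0 < C'.card)
    have hdisj : ∀ j ∈ C, j ∉ C' := fun j hj hj' => by simpa [hj] using hC' hj'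
    exact ⟨C', s', hcard, hs', fun j hj hj' => (hdisj j hj hj').elim,
      s, hs, s', hs', fun h => hdisj s hs (h ▸ hs')⟩

/-- If all triples of consecutive layer sizes `N i, N (i + 1), N (i + 2)` can be distributed over
`K` colors within the bounds `M`, then the whole sequence can be distributed coherently. -/
theorem exists_color_distribution {K : ℕ} (hK : 2 ≤ K) (N M : ℕ → ℕ) (hN : ∀ i, 0 < N i)
    (hM : ∀ i, 0 < M i)
    (hwin : ∀ i, ∃ x y z : Fin K → ℕ, ∑ j, x j = N i ∧ ∑ j, y j = N (i + 1) ∧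
      ∑ j, z j = N (i + 2) ∧ (∀ j, 0 < x j → x j + y j ≤ M i) ∧
      (∀ j, 0 < y j → x j + y j + z j ≤ M (i + 1)) ∧
      ∀ j, 0 < z j → y j + z j ≤ M (i + 2)) :
    ∃ c : ℕ → Fin K → ℕ, (∀ i, ∑ j, c i j = N i) ∧
      (∀ i j, 0 < c (i + 1) j → c i j + c (i + 1) j + c (i + 2) j ≤ M (i + 1)) ∧
      ∀ i, ∃ j k, j ≠ k ∧ 0 < c i j ∧ 0 < c (i + 1) k := by
  set q : ℕ → ℕ := fun i => (N i - 1) / M i with hq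
  set ρ : ℕ → ℕ := fun i => (N i - 1) % M i + 1 with hρ
  have hNq : ∀ i, N i = q i * M i + ρ i := fun i => by
    have h₁ := Nat.div_add_mod' (N i - 1) (M i)
    have h₂ := hN i
    simp only [hq, hρ]
    omega
  have hρpos : ∀ i, 0 < ρ i := fun i => Nat.succ_pos _
  have hρM : ∀ i, ρ i ≤ M i := fun i => Nat.mod_lt _ (hM i)
  have hpair : ∀ i, q i + q (i + 1) + 1 ≤ K ∧ (q i + q (i + 1) + 1 = K →
      ρ i + ρ (i + 1) ≤ M i ∧ ρ i + ρ (i + 1) ≤ M (i + 1)) := fun i => by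
    obtain ⟨x, y, z, hx, hy, hz, h₁, h₂, h₃⟩ := hwin i
    exact pair_bound h₁ (fun j hj => (Nat.le_add_right _ _).trans (h₂ j hj))
      (hx.trans (hNq i)) (hy.trans (hNq _)) (hρpos _) (hρpos _)
  have htriple : ∀ i, q i + q (i + 1) + 1 = K → q (i + 1) + q (i + 2) + 1 = K →
      ρ i + ρ (i + 1) + ρ (i + 2) ≤ M (i + 1) := fun i hi hi' => by
    obtain ⟨x, y, z, hx, hy, hz, h₁, h₂, h₃⟩ := hwin i
    exact triple_bound h₁ h₂ h₃ (hx.trans (hNq i)) (hy.trans (hNq _)) (hz.trans (hNq _))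
      (hρpos _) (hρpos _) hi hi'
  obtain ⟨C₀, -, hC₀⟩ := exists_subset_card_eq (s := (univ : Finset (Fin K))) (n := q 0 + 1)
    (by have := (hpair 0).1; simp; omega)
  obtain ⟨s₀, hs₀⟩ := card_pos.mp (by omega : 0 < C₀.card)
  obtain ⟨f, hf⟩ := exists_seq_rel
    (α := fun i => {p : Finset (Fin K) × Fin K // p.1.card = q i + 1 ∧ p.2 ∈ p.1})
    ⟨(C₀, s₀), hC₀, hs₀⟩
    (fun i a b => (∀ j ∈ a.1.1, j ∈ b.1.1 → j = a.1.2 ∧ j = b.1.2 ∧ q i + q (i + 1) + 1 = K) ∧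
      ∃ j ∈ a.1.1, ∃ k ∈ b.1.1, j ≠ k)
    (fun i a => by
      obtain ⟨C', s', h₁, h₂, h₃⟩ :=
        exists_next_color_set hK (hpair i).1 a.1.1 a.1.2 a.2.1 a.2.2
      exact ⟨⟨(C', s'), h₁, h₂⟩, h₃⟩)
  set C : ℕ → Finset (Fin K) := fun i => (f i).1.1
  set s : ℕ → Fin K := fun i => (f i).1.2
  have hcard : ∀ i, (C i).card = q i + 1 := fun i => (f i).2.1
  have hsC : ∀ i, s i ∈ C i := fun i => (f i).2.2
  have hmeet : ∀ i, ∀ j ∈ C i, j ∈ C (i + 1) → j = s i ∧ j = s (i + 1) ∧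
    q i + q (i + 1) + 1 = K := fun i => (hf i).1
  have hcross : ∀ i, ∃ j ∈ C i, ∃ k ∈ C (i + 1), j ≠ k := fun i => (hf i).2
  clear_value C s
  set c : ℕ → Fin K → ℕ := fun i j => if j ∈ C i then if j = s i then ρ i else M i else 0
    with hc
  have hout : ∀ i j, j ∉ C i → c i j = 0 := fun i j h => by simp [hc, h]
  have hself : ∀ i, c i (s i) = ρ i := fun i => by simp [hc, hsC]
  have hne : ∀ i j, j ∈ C i → j ≠ s i → c i j = M i := fun i j h h' => by simp [hc, h, h']
  have hle : ∀ i j, c i j ≤ M i := fun i j => by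
    have := hρM i
    simp only [hc]
    split_ifs <;> omega
  have hpos : ∀ i j, j ∈ C i → 0 < c i j := fun i j h => by
    have := hρpos i
    have := hM i
    simp only [hc, h, if_true]
    split_ifs <;> omega
  have hmem : ∀ i j, 0 < c i j → j ∈ C i := fun i j h => by
    by_contra h'
    rw [hout i j h'] at h
    exact h.false
  refine ⟨c, fun i => ?_, fun i j hj => ?_, fun i => ?_⟩
  · have h₁ : ∑ j, c i j = ∑ j ∈ C i, c i j :=
      (sum_subset (subset_univ _) fun j _ hj => hout i j hj).symm
    rw [h₁, ← add_sum_erase _ _ (hsC i), hself, sum_congr rfl fun j hj =>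
      hne i j (mem_of_mem_erase hj) (ne_of_mem_erase hj), sum_const, card_erase_of_mem (hsC i),
      hcard, hNq i, smul_eq_mul, Nat.add_sub_cancel, add_comm]
  · have hj' := hmem _ _ hj
    by_cases h₁ : j ∈ C i <;> by_cases h₂ : j ∈ C (i + 2)
    · obtain ⟨rfl, e₁, t₁⟩ := hmeet i j h₁ hj'
      obtain ⟨-, e₂, t₂⟩ := hmeet (i + 1) _ hj' h₂
      have e₃ := hself (i + 1)
      have e₄ := hself (i + 2)
      rw [← e₁] at e₃
      rw [← e₂] at e₄
      rw [hself, e₃, e₄]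
      exact htriple i t₁ t₂
    · obtain ⟨rfl, e₁, t₁⟩ := hmeet i j h₁ hj'
      have e₃ := hself (i + 1)
      rw [← e₁] at e₃
      rw [hself, e₃, hout _ _ h₂]
      exact ((hpair i).2 t₁).2
    · obtain ⟨rfl, e₂, t₂⟩ := hmeet (i + 1) j hj' h₂
      have e₄ := hself (i + 2)
      rw [← e₂] at e₄
      rw [hself, e₄, hout _ _ h₁, zero_add]
      exact ((hpair (i + 1)).2 t₂).1
    · rw [hout _ _ h₁, hout _ _ h₂]
      simpa using hle (i + 1) j
  · obtain ⟨j, hj, k, hk, hjk⟩ := hcross i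
    exact ⟨j, k, hjk, hpos _ _ hj, hpos _ _ hk⟩

/-- The graph on layers `0, …, L` with `c i j` vertices of color `j` in layer `i`, in which two
vertices are adjacent when their colors differ and their layers are equal or consecutive. -/
def layeredGraph {K : ℕ} (c : ℕ → Fin K → ℕ) (L : ℕ) :
    SimpleGraph (Σ p : Fin (L + 1) × Fin K, Fin (c p.1 p.2)) where
  Adj a b := a.1.2 ≠ b.1.2 ∧ (a.1.1 : ℕ) ≤ b.1.1 + 1 ∧ (b.1.1 : ℕ) ≤ a.1.1 + 1
  symm := ⟨fun _ _ h => ⟨h.1.symm, h.2.2, h.2.1⟩⟩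
  loopless := ⟨fun _ h => h.1 rfl⟩

theorem layeredGraph_colorable {K : ℕ} (c : ℕ → Fin K → ℕ) (L : ℕ) :
    (layeredGraph c L).Colorable K :=
  ⟨SimpleGraph.Coloring.mk (fun a => a.1.2) fun h => h.1⟩

theorem card_layeredGraph {K : ℕ} (c : ℕ → Fin K → ℕ) (L : ℕ) :
    Fintype.card (Σ p : Fin (L + 1) × Fin K, Fin (c p.1 p.2)) =
      ∑ i ∈ range (L + 1), ∑ j, c i j := by
  simp only [Fintype.card_sigma, Fintype.card_fin]
  rw [Fintype.sum_prod_type, Finset.sum_range]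

theorem sum_le_ncard_neighborSet_layeredGraph {K : ℕ} (c : ℕ → Fin K → ℕ) (L : ℕ)
    (v : Σ p : Fin (L + 1) × Fin K, Fin (c p.1 p.2)) (P : Finset (Fin (L + 1) × Fin K))
    (hP : ∀ p ∈ P, v.1.2 ≠ p.2 ∧ (v.1.1 : ℕ) ≤ p.1 + 1 ∧ (p.1 : ℕ) ≤ v.1.1 + 1) :
    ∑ p ∈ P, c p.1 p.2 ≤ ((layeredGraph c L).neighborSet v).ncard := by
  have h : ((P.sigma fun p => (univ : Finset (Fin (c p.1 p.2)))) : Set _) ⊆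
      (layeredGraph c L).neighborSet v := fun w hw => hP w.1 (by simpa using hw)
  have := Set.ncard_le_ncard h (Set.toFinite _)
  rw [Set.ncard_coe_finset, card_sigma] at this
  simpa using this

theorem layeredGraph_connected {K : ℕ} (c : ℕ → Fin K → ℕ) (L : ℕ) (hL : 0 < L)
    (hc : ∀ i < L, ∃ j k, j ≠ k ∧ 0 < c i j ∧ 0 < c (i + 1) k) :
    (layeredGraph c L).Connected := by
  have hpair : ∀ i < L, ∀ a b : Σ p : Fin (L + 1) × Fin K, Fin (c p.1 p.2),
      ((a.1.1 : ℕ) = i ∨ (a.1.1 : ℕ) = i + 1) → ((b.1.1 : ℕ) = i ∨ (b.1.1 : ℕ) = i + 1) →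
      (layeredGraph c L).Reachable a b := by
    intro i hi a b ha hb
    obtain ⟨j, k, hjk, hj, hk⟩ := hc i hi
    let u : Σ p : Fin (L + 1) × Fin K, Fin (c p.1 p.2) := ⟨(⟨i, by omega⟩, j), ⟨0, hj⟩⟩
    let w : Σ p : Fin (L + 1) × Fin K, Fin (c p.1 p.2) := ⟨(⟨i + 1, by omega⟩, k), ⟨0, hk⟩⟩
    have huw : (layeredGraph c L).Adj u w := ⟨hjk, by simp [u, w]; omega, by simp [u, w]⟩
    have key : ∀ a : Σ p : Fin (L + 1) × Fin K, Fin (c p.1 p.2),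
        ((a.1.1 : ℕ) = i ∨ (a.1.1 : ℕ) = i + 1) → (layeredGraph c L).Reachable a u := by
      intro a ha
      by_cases h : a.1.2 = j
      · have : (layeredGraph c L).Adj a w :=
          ⟨h.symm ▸ hjk, by simp only [w]; omega, by simp only [w]; omega⟩
        exact this.reachable.trans huw.symm.reachable
      · exact SimpleGraph.Adj.reachable ⟨h, by simp only [u]; omega, by simp only [u]; omega⟩
    exact (key a ha).trans (key b hb).symm
  obtain ⟨j₀, -, -, hj₀, -⟩ := hc 0 hL
  let r : Σ p : Fin (L + 1) × Fin K, Fin (c p.1 p.2) := ⟨(⟨0, by omega⟩, j₀), ⟨0, hj₀⟩⟩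
  have hroot : ∀ i, ∀ a : Σ p : Fin (L + 1) × Fin K, Fin (c p.1 p.2), (a.1.1 : ℕ) = i →
      (layeredGraph c L).Reachable a r := by
    intro i
    induction i with
    | zero => exact fun a ha => hpair 0 hL a r (Or.inl ha) (Or.inl rfl)
    | succ i ih =>
      intro a ha
      have hi : i < L := by have := a.1.1.2; omega
      obtain ⟨j, -, -, hj, -⟩ := hc i hi
      exact (hpair i hi a ⟨(⟨i, by omega⟩, j), ⟨0, hj⟩⟩ (Or.inr ha) (Or.inl rfl)).trans
        (ih _ rfl)
  exact (SimpleGraph.connected_iff _).mpr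
    ⟨fun a b => (hroot _ a rfl).trans (hroot _ b rfl).symm, ⟨r⟩⟩

theorem SimpleGraph.Walk.le_add_length_of_lipschitz {V : Type*} {G : SimpleGraph V} (f : V → ℕ)
    (hf : ∀ a b, G.Adj a b → f b ≤ f a + 1) {a b : V} (p : G.Walk a b) :
    f b ≤ f a + p.length := by
  induction p with
  | nil => simp
  | cons h p ih =>
    have := hf _ _ h
    rw [SimpleGraph.Walk.length_cons]
    omega

theorem SimpleGraph.Connected.le_add_diam_of_lipschitz {V : Type*} [Finite V]
    {G : SimpleGraph V} (hconn : G.Connected) (f : V → ℕ)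
    (hf : ∀ a b, G.Adj a b → f b ≤ f a + 1) (a b : V) : f b ≤ f a + G.diam := by
  obtain ⟨p, hp⟩ := hconn.exists_walk_length_eq_dist a b
  have h₁ := p.le_add_length_of_lipschitz f hf
  have : Nonempty V := ⟨a⟩
  have h₂ := SimpleGraph.dist_le_diam (SimpleGraph.connected_iff_ediam_ne_top.mp hconn)
    (u := a) (v := b)
  omega

/-- A coherent distribution of layer sizes over colors yields connected `K`-colorable graphs of
minimum degree at least `δ` with `T` prescribed layers and two bounded end layers. -/
theorem exists_graph_of_color_distribution {K : ℕ} (hK : 2 ≤ K) (δ : ℕ) (N M : ℕ → ℕ)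
    (c : ℕ → Fin K → ℕ) (hsum : ∀ i, ∑ j, c i j = N i)
    (hM : ∀ i j, 0 < c (i + 1) j → c i j + c (i + 1) j + c (i + 2) j ≤ M (i + 1))
    (hcross : ∀ i, ∃ j k, j ≠ k ∧ 0 < c i j ∧ 0 < c (i + 1) k)
    (hδ : ∀ i, δ + M (i + 1) ≤ N i + N (i + 1) + N (i + 2)) (T : ℕ) (hT : 0 < T) :
    ∃ (n : ℕ) (H : SimpleGraph (Fin n)), n = ∑ i ∈ range T, N i + 4 * (δ + 1) ∧
      H.Connected ∧ (∀ v, δ ≤ (H.neighborSet v).ncard) ∧ H.Colorable K ∧ T ≤ H.diam := by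
  let j₀ : Fin K := ⟨0, by omega⟩
  let j₁ : Fin K := ⟨1, by omega⟩
  have hj : j₀ ≠ j₁ := by simp [j₀, j₁]
  let e : Fin K → ℕ := fun j => if j = j₀ ∨ j = j₁ then δ + 1 else 0
  have he : ∀ j, ∃ k, j ≠ k ∧ e k = δ + 1 := fun j => by
    by_cases h : j = j₀
    · exact ⟨j₁, h ▸ hj, by simp [e]⟩
    · exact ⟨j₀, h, by simp [e]⟩
  have hesum : ∑ j, e j = 2 * (δ + 1) := by
    have : (univ.filter fun j => j = j₀ ∨ j = j₁) = {j₀, j₁} := by ext; simp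
    simp only [e]
    rw [← sum_filter, this, sum_pair hj]
    ring
  let c' : ℕ → Fin K → ℕ := fun i => if i = 0 ∨ i = T + 1 then e else c (i - 1)
  have hc'0 : c' 0 = e := by simp [c']
  have hc'T : c' (T + 1) = e := by simp [c']
  have hc' : ∀ i < T, c' (i + 1) = c i := fun i hi => by
    have : ¬ i = T := by omega
    simp [c', this]
  have hcross' : ∀ i < T + 1, ∃ j k, j ≠ k ∧ 0 < c' i j ∧ 0 < c' (i + 1) k := by
    intro i hi
    rcases Nat.eq_zero_or_pos i with rfl | hi0
    · obtain ⟨j, -, -, h, -⟩ := hcross 0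
      obtain ⟨k, hjk, hk⟩ := he j
      exact ⟨k, j, hjk.symm, by rw [hc'0, hk]; omega, by rwa [hc' 0 hT]⟩
    · obtain ⟨i, rfl⟩ := Nat.exists_eq_add_of_lt hi0
      rw [zero_add] at *
      rw [hc' i (by omega)]
      obtain ⟨j, k, hjk, h₁, h₂⟩ := hcross i
      by_cases hiT : i + 1 = T
      · obtain ⟨k', hjk', hk'⟩ := he j
        exact ⟨j, k', hjk', h₁, by rw [hiT, hc'T, hk']; omega⟩
      · rw [hc' (i + 1) (by omega)]
        exact ⟨j, k, hjk, h₁, h₂⟩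
  have hdeg : ∀ v, δ ≤ ((layeredGraph c' (T + 1)).neighborSet v).ncard := by
    rintro ⟨⟨⟨i, hi⟩, j⟩, t⟩
    obtain ⟨k, hjk, hk⟩ := he j
    by_cases h₁ : i ≤ 1
    · have := sum_le_ncard_neighborSet_layeredGraph c' (T + 1) ⟨⟨⟨i, hi⟩, j⟩, t⟩
        {(⟨0, by omega⟩, k)} (by simp [hjk, h₁])
      rw [sum_singleton, hc'0, hk] at this
      omega
    by_cases h₂ : T ≤ i
    · have := sum_le_ncard_neighborSet_layeredGraph c' (T + 1) ⟨⟨⟨i, hi⟩, j⟩, t⟩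
        {(⟨T + 1, by omega⟩, k)} (by simp [hjk, h₂]; omega)
      rw [sum_singleton, hc'T, hk] at this
      omega
    obtain ⟨i, rfl⟩ : ∃ i', i = i' + 2 := ⟨i - 2, by omega⟩
    have hpos : 0 < c (i + 1) j := by
      have := t.pos
      simp only at this
      rwa [hc' (i + 1) (by omega)] at this
    have h := sum_le_ncard_neighborSet_layeredGraph c' (T + 1) ⟨⟨⟨i + 2, hi⟩, j⟩, t⟩
      (({⟨i + 1, by omega⟩, ⟨i + 2, by omega⟩, ⟨i + 3, by omega⟩} : Finset (Fin (T + 1 + 1))) ×ˢ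
        univ.erase j) (by
        rintro ⟨a, b⟩ hab
        simp only [mem_product, mem_insert, mem_singleton, mem_erase, mem_univ, and_true] at hab
        obtain ⟨rfl | rfl | rfl, hb⟩ := hab <;> exact ⟨hb.symm, by simp, by simp⟩)
    rw [sum_product, sum_insert (by simp), sum_insert (by simp), sum_singleton] at h
    simp only at h
    rw [hc' i (by omega), hc' (i + 1) (by omega), hc' (i + 2) (by omega)] at h
    have e₁ := add_sum_erase univ (c i) (mem_univ j)
    have e₂ := add_sum_erase univ (c (i + 1)) (mem_univ j)
    have e₃ := add_sum_erase univ (c (i + 2)) (mem_univ j)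
    rw [hsum] at e₁ e₂ e₃
    have := hM i j hpos
    have := hδ i
    omega
  have hcard : Fintype.card (Σ p : Fin (T + 1 + 1) × Fin K, Fin (c' p.1 p.2)) =
      ∑ i ∈ range T, N i + 4 * (δ + 1) := by
    rw [card_layeredGraph, sum_range_succ, sum_range_succ', hc'0, hc'T, hesum,
      sum_congr rfl fun i hi => by rw [hc' i (mem_range.mp hi), hsum i]]
    ring
  let f := (layeredGraph c' (T + 1)).overFinIso hcard
  have hconn := f.connected_iff.mp (layeredGraph_connected _ _ T.succ_pos hcross')
  refine ⟨_, (layeredGraph c' (T + 1)).overFin hcard, rfl, hconn, fun v => ?_,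
    (layeredGraph_colorable _ _).of_hom f.symm.toHom, ?_⟩
  · have h := Set.ncard_congr' (f.symm.mapNeighborSet v)
    rw [h]
    exact hdeg _
  · have h := hconn.le_add_diam_of_lipschitz (fun v => ((f.symm v).1.1 : ℕ))
      (fun a b hab => (f.symm.map_adj_iff.mpr hab).2.2)
      (f ⟨(⟨0, by omega⟩, j₀), ⟨0, by simp [hc'0, e]⟩⟩)
      (f ⟨(⟨T + 1, by omega⟩, j₀), ⟨0, by simp [hc'T, e]⟩⟩)
    simp only [RelIso.symm_apply_apply] at h
    omega

section Layers

variable {V : Type*} (G : SimpleGraph V) (N₀ : Set V)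

/-- The distance from the set `N₀` to the vertex `v`. -/
noncomputable def layerIndex (v : V) : ℕ :=
  sInf ((fun u => G.dist u v) '' N₀)

variable {G N₀}

theorem exists_dist_eq_layerIndex (hN₀ : N₀.Nonempty) (v : V) :
    ∃ u ∈ N₀, G.dist u v = layerIndex G N₀ v :=
  Nat.sInf_mem (hN₀.image fun u => G.dist u v)

theorem layerIndex_le {u : V} (hu : u ∈ N₀) (v : V) : layerIndex G N₀ v ≤ G.dist u v :=
  Nat.sInf_le (Set.mem_image_of_mem _ hu)

theorem mem_layer_iff (hN₀ : N₀.Nonempty) {v : V} {i : ℕ} :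
    v ∈ layer G N₀ i ↔ layerIndex G N₀ v = i := by
  obtain ⟨u, hu, huv⟩ := exists_dist_eq_layerIndex (G := G) hN₀ v
  constructor
  · rintro ⟨⟨w, hw, hwv⟩, h⟩
    exact le_antisymm (hwv ▸ layerIndex_le hw v) (huv ▸ h u hu)
  · rintro rfl
    exact ⟨⟨u, hu, huv⟩, fun w hw => layerIndex_le hw v⟩

theorem layerIndex_le_add_one (hconn : G.Connected) (hN₀ : N₀.Nonempty) {a b : V}
    (h : G.Adj a b) : layerIndex G N₀ b ≤ layerIndex G N₀ a + 1 := by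
  obtain ⟨u, hu, hua⟩ := exists_dist_eq_layerIndex (G := G) hN₀ a
  have h₁ := layerIndex_le (G := G) hu b
  have h₂ := hconn.dist_triangle (u := u) (v := a) (w := b)
  have h₃ := SimpleGraph.dist_eq_one_iff_adj.mpr h
  omega

theorem SimpleGraph.Walk.exists_eq_of_lipschitz (f : V → ℕ)
    (hf : ∀ a b, G.Adj a b → f b ≤ f a + 1) {a b : V} (p : G.Walk a b) {i : ℕ}
    (ha : f a ≤ i) (hb : i ≤ f b) : ∃ v, f v = i := by
  induction p with
  | nil => exact ⟨_, le_antisymm ha hb⟩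
  | @cons u v w h p ih =>
    by_cases hi : f u = i
    · exact ⟨u, hi⟩
    · exact ih (by have := hf _ _ h; omega) hb

theorem layer_nonempty (hconn : G.Connected) (hN₀ : N₀.Nonempty) {d i : ℕ}
    (hlast : (layer G N₀ d).Nonempty) (hi : i ≤ d) : (layer G N₀ i).Nonempty := by
  obtain ⟨u, hu⟩ := hN₀
  obtain ⟨w, hw⟩ := hlast
  obtain ⟨p⟩ := hconn u w
  have hu0 : layerIndex G N₀ u ≤ 0 := by simpa using layerIndex_le (G := G) hu u
  rw [mem_layer_iff ⟨u, hu⟩] at hw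
  obtain ⟨v, hv⟩ := p.exists_eq_of_lipschitz (layerIndex G N₀)
    (fun a b h => layerIndex_le_add_one hconn ⟨u, hu⟩ h) (i := i) (by omega) (by omega)
  exact ⟨v, (mem_layer_iff ⟨u, hu⟩).mpr hv⟩

theorem ncard_neighborSet_inter_le [Finite V] {A B : Set V} (ψ : G.induce A ≃g G.induce B)
    (x : A) : (G.neighborSet (ψ x) ∩ B).ncard ≤ (G.neighborSet x).ncard := by
  have h₁ : G.neighborSet (ψ x) ∩ B ⊆ (fun a => (ψ a : V)) '' {a : A | G.Adj x a} := by
    rintro w ⟨hw, hwB⟩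
    refine ⟨ψ.symm ⟨w, hwB⟩, ?_, by simp⟩
    have h : (G.induce A).Adj x (ψ.symm ⟨w, hwB⟩) := by
      rw [← ψ.map_adj_iff, RelIso.apply_symm_apply]
      exact hw
    exact h
  have h₂ : Subtype.val '' {a : A | G.Adj x a} ⊆ G.neighborSet x := by
    rintro _ ⟨a, ha, rfl⟩
    exact ha
  calc _ ≤ _ := Set.ncard_le_ncard h₁ (Set.toFinite _)
    _ ≤ _ := Set.ncard_image_le (Set.toFinite _)
    _ = _ := (Set.ncard_image_of_injective _ Subtype.val_injective).symm
    _ ≤ _ := Set.ncard_le_ncard h₂ (Set.toFinite _)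

theorem ncard_eq_of_equiv {A B S T : Set V} (ψ : A ≃ B) (hS : S ⊆ A) (hT : T ⊆ B)
    (h : ∀ a : A, (a : V) ∈ S ↔ (ψ a : V) ∈ T) : S.ncard = T.ncard := by
  have h₁ : Subtype.val '' {a : A | (a : V) ∈ S} = S := by
    ext v
    exact ⟨by rintro ⟨a, ha, rfl⟩; exact ha, fun hv => ⟨⟨v, hS hv⟩, hv, rfl⟩⟩
  have h₂ : (fun a => (ψ a : V)) '' {a : A | (a : V) ∈ S} = T := by
    ext v
    constructor
    · rintro ⟨a, ha, rfl⟩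
      exact (h a).mp ha
    · intro hv
      exact ⟨ψ.symm ⟨v, hT hv⟩, (h _).mpr (by simpa using hv), by simp⟩
  rw [← h₁, ← h₂, Set.ncard_image_of_injective _ Subtype.val_injective,
    Set.ncard_image_of_injective (f := fun a => (ψ a : V)) _
      (Subtype.val_injective.comp ψ.injective)]

variable [Fintype V]

theorem sum_ncard_layer_inter_color {K : ℕ} (col : V → Fin K) (S : Set V) :
    ∑ j, {v ∈ S | col v = j}.ncard = S.ncard := by
  classical
  have h := card_eq_sum_card_fiberwise (s := S.toFinset) (t := univ) (f := col)
    fun _ _ => by simp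
  rw [Set.ncard_eq_toFinset_card' S, h]
  refine sum_congr rfl fun j _ => ?_
  rw [← Set.ncard_coe_finset]
  congr 1
  ext v
  simp

theorem ncard_neighborSet_add_sum_le {K : ℕ} (col : G.Coloring (Fin K)) (v : V) (s : Finset ℕ)
    (hs : ∀ w, G.Adj v w → ∃ i ∈ s, w ∈ layer G N₀ i) :
    (G.neighborSet v).ncard + ∑ i ∈ s, {w ∈ layer G N₀ i | col w = col v}.ncard ≤
      ∑ i ∈ s, (layer G N₀ i).ncard := by
  have h₁ : (G.neighborSet v).ncard ≤
      ∑ i ∈ s, {w ∈ layer G N₀ i | col w ≠ col v}.ncard := by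
    refine (Set.ncard_le_ncard (t := ⋃ i ∈ s, {w ∈ layer G N₀ i | col w ≠ col v})
      (fun w hw => ?_) (Set.toFinite _)).trans (Finset.set_ncard_biUnion_le s _)
    obtain ⟨i, hi, hwi⟩ := hs w hw
    simp only [Set.mem_iUnion]
    exact ⟨i, hi, hwi, (col.valid hw).symm⟩
  have h₂ : ∀ i, (layer G N₀ i).ncard = {w ∈ layer G N₀ i | col w = col v}.ncard +
      {w ∈ layer G N₀ i | col w ≠ col v}.ncard := fun i => by
    rw [← Set.ncard_union_eq ?_ (Set.toFinite _) (Set.toFinite _)]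
    · congr 1
      ext w
      simp only [Set.mem_union, Set.mem_ofPred_eq]
      tauto
    · exact Set.disjoint_left.mpr fun w hw hw' => hw'.2 hw.2
  rw [sum_congr rfl fun i _ => h₂ i, sum_add_distrib]
  omega

theorem le_ncard_neighborSet_add {A B R : Set V} (ψ : G.induce A ≃g G.induce B) (x : A) {δ : ℕ}
    (hδ : δ ≤ (G.neighborSet (ψ x)).ncard) (hR : G.neighborSet (ψ x) ⊆ B ∪ R) :
    δ ≤ (G.neighborSet x).ncard + R.ncard := by
  have h : G.neighborSet (ψ x) ⊆ (G.neighborSet (ψ x) ∩ B) ∪ R := fun w hw =>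
    (hR hw).imp (fun hB => ⟨hw, hB⟩) id
  have h₁ := Set.ncard_le_ncard h (Set.toFinite _)
  have h₂ := Set.ncard_union_le (G.neighborSet (ψ x) ∩ B) R
  have h₃ := ncard_neighborSet_inter_le ψ x
  omega

/-- The layer sizes of a repeatable graph, together with suitable bounds `M` on the color classes
in consecutive layers, form a sequence that closes up periodically with period `p = d - 1`. -/
theorem exists_color_windows {K δ p : ℕ} (hp : 0 < p) (hconn : G.Connected)
    (hN₀ : N₀.Nonempty) (hlast : (layer G N₀ (p + 1)).Nonempty)
    (hmax : ∀ i, p + 1 < i → layer G N₀ i = ∅)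
    (φ : G.induce (layer G N₀ 0 ∪ layer G N₀ 1) ≃g G.induce (layer G N₀ p ∪ layer G N₀ (p + 1)))
    (hφ₀ : ∀ x : (layer G N₀ 0 ∪ layer G N₀ 1 : Set V),
      (x : V) ∈ layer G N₀ 0 → (φ x : V) ∈ layer G N₀ p)
    (hφ₁ : ∀ x : (layer G N₀ 0 ∪ layer G N₀ 1 : Set V),
      (x : V) ∈ layer G N₀ 1 → (φ x : V) ∈ layer G N₀ (p + 1))
    (col : G.Coloring (Fin K))
    (hdeg : ∀ v, v ∉ layer G N₀ 0 ∪ layer G N₀ (p + 1) → δ ≤ (G.neighborSet v).ncard)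
    {n : ℕ → ℕ} (hn : ∀ i, n i = (layer G N₀ i).ncard) :
    n 0 = n p ∧ n 1 = n (p + 1) ∧ ∃ M : ℕ → ℕ, M 0 = M p ∧ M 1 = M (p + 1) ∧
      ∀ k < p, 0 < n (k + 1) ∧ 0 < M (k + 1) ∧
        δ + M (k + 1) = n k + n (k + 1) + n (k + 2) ∧
        ∃ x y z : Fin K → ℕ, ∑ j, x j = n k ∧ ∑ j, y j = n (k + 1) ∧ ∑ j, z j = n (k + 2) ∧
          (∀ j, 0 < x j → x j + y j ≤ M k) ∧
          (∀ j, 0 < y j → x j + y j + z j ≤ M (k + 1)) ∧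
          ∀ j, 0 < z j → y j + z j ≤ M (k + 2) := by
  have hadj : ∀ {v w i}, v ∈ layer G N₀ i → G.Adj v w →
      ∃ l, w ∈ layer G N₀ l ∧ l ≤ i + 1 ∧ i ≤ l + 1 ∧ l ≤ p + 1 := by
    intro v w i hv h
    rw [mem_layer_iff hN₀] at hv
    have h₁ := layerIndex_le_add_one hconn hN₀ h
    have h₂ := layerIndex_le_add_one hconn hN₀ h.symm
    refine ⟨_, (mem_layer_iff hN₀).mpr rfl, by omega, by omega, ?_⟩
    by_contra! hlt
    have : w ∈ layer G N₀ (layerIndex G N₀ w) := (mem_layer_iff hN₀).mpr rfl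
    rw [hmax _ hlt] at this
    exact this
  have hdisj : ∀ {v i l}, v ∈ layer G N₀ i → v ∈ layer G N₀ l → i = l := by
    intro v i l h₁ h₂
    rw [mem_layer_iff hN₀] at h₁ h₂
    omega
  have hdeg' : ∀ {v k}, k < p → v ∈ layer G N₀ (k + 1) → δ ≤ (G.neighborSet v).ncard := by
    intro v k hk hv
    refine hdeg v fun h => ?_
    rcases h with h | h <;> have := hdisj hv h <;> omega
  have hφ₀' : ∀ x : (layer G N₀ 0 ∪ layer G N₀ 1 : Set V),
      (x : V) ∈ layer G N₀ 0 ↔ (φ x : V) ∈ layer G N₀ p := fun x =>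
    ⟨hφ₀ x, fun h => x.2.resolve_right fun h₁ => by have := hdisj h (hφ₁ x h₁); omega⟩
  have hφ₁' : ∀ x : (layer G N₀ 0 ∪ layer G N₀ 1 : Set V),
      (x : V) ∈ layer G N₀ 1 ↔ (φ x : V) ∈ layer G N₀ (p + 1) := fun x =>
    ⟨hφ₁ x, fun h => x.2.resolve_left fun h₀ => by have := hdisj h (hφ₀ x h₀); omega⟩
  have hn₀ : n 0 = n p := by
    rw [hn, hn]
    exact ncard_eq_of_equiv φ.toEquiv Set.subset_union_left Set.subset_union_left hφ₀'
  have hn₁ : n 1 = n (p + 1) := by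
    rw [hn, hn]
    exact ncard_eq_of_equiv φ.toEquiv Set.subset_union_right Set.subset_union_right hφ₁'
  let X : ℕ → Fin K → ℕ := fun i j => {w ∈ layer G N₀ i | col w = j}.ncard
  have hX : ∀ i, ∑ j, X i j = n i := fun i => by
    rw [hn]
    exact sum_ncard_layer_inter_color col _
  have hXpos : ∀ {i j}, 0 < X i j → ∃ v ∈ layer G N₀ i, col v = j := fun h =>
    (Set.ncard_pos (Set.toFinite _)).mp h
  have hmid : ∀ k < p, ∀ v ∈ layer G N₀ (k + 1),
      δ + (X k (col v) + X (k + 1) (col v) + X (k + 2) (col v)) ≤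
        n k + n (k + 1) + n (k + 2) := by
    intro k hk v hv
    have h := ncard_neighborSet_add_sum_le (N₀ := N₀) col v {k, k + 1, k + 2} (fun w hw => by
      obtain ⟨l, hl, h₁, h₂, -⟩ := hadj hv hw
      exact ⟨l, by simp only [mem_insert, mem_singleton]; omega, hl⟩)
    rw [sum_insert (by simp), sum_pair (by simp), sum_insert (by simp), sum_pair (by simp),
      ← hn, ← hn, ← hn] at h
    have := hdeg' hk hv
    simp only [X]
    omega
  have hbot : ∀ v ∈ layer G N₀ 0, δ + (X 0 (col v) + X 1 (col v)) ≤ n (p - 1) + n 0 + n 1 := by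
    intro v hv
    have h := ncard_neighborSet_add_sum_le (N₀ := N₀) col v {0, 1} (fun w hw => by
      obtain ⟨l, hl, h₁, -, -⟩ := hadj hv hw
      exact ⟨l, by simp only [mem_insert, mem_singleton]; omega, hl⟩)
    rw [sum_pair (by simp), sum_pair (by simp), ← hn, ← hn] at h
    have hv' := hφ₀ ⟨v, Or.inl hv⟩ hv
    have h' := le_ncard_neighborSet_add (R := layer G N₀ (p - 1)) (δ := δ) φ ⟨v, Or.inl hv⟩
      (hdeg' (k := p - 1) (by omega) (by rwa [Nat.sub_add_cancel hp])) (fun w hw => by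
        obtain ⟨l, hl, h₁, h₂, -⟩ := hadj hv' hw
        obtain rfl | rfl | rfl : l = p ∨ l = p + 1 ∨ l = p - 1 := by omega
        exacts [Or.inl (Or.inl hl), Or.inl (Or.inr hl), Or.inr hl])
    simp only [← hn] at h'
    simp only [X]
    omega
  have htop : ∀ v ∈ layer G N₀ (p + 1),
      δ + (X p (col v) + X (p + 1) (col v)) ≤ n p + n (p + 1) + n 2 := by
    intro v hv
    have h := ncard_neighborSet_add_sum_le (N₀ := N₀) col v {p, p + 1} (fun w hw => by
      obtain ⟨l, hl, h₁, h₂, h₃⟩ := hadj hv hw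
      exact ⟨l, by simp only [mem_insert, mem_singleton]; omega, hl⟩)
    rw [sum_pair (by simp), sum_pair (by simp), ← hn, ← hn] at h
    have hv' := (hφ₁' (φ.symm ⟨v, Or.inr hv⟩)).mpr (by simpa using hv)
    have h' := le_ncard_neighborSet_add (R := layer G N₀ 2) (δ := δ) φ.symm ⟨v, Or.inr hv⟩
      (hdeg' hp hv') (fun w hw => by
        obtain ⟨l, hl, h₁, h₂, -⟩ := hadj hv' hw
        obtain rfl | rfl | rfl : l = 0 ∨ l = 1 ∨ l = 2 := by omega
        exacts [Or.inl (Or.inl hl), Or.inl (Or.inr hl), Or.inr hl])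
    simp only [← hn] at h'
    simp only [X]
    omega
  let S : ℕ → ℕ := fun k => n k + n (k + 1) + n (k + 2) - δ
  let M : ℕ → ℕ := fun r => if r = 0 then S (p - 1) else if r = p + 1 then S 0 else S (r - 1)
  have hM0 : M 0 = S (p - 1) := by simp [M]
  have hMtop : M (p + 1) = S 0 := by simp [M]
  have hMmid : ∀ k < p, M (k + 1) = S k := fun k hk => by simp [M, hk.ne]
  obtain ⟨p, rfl⟩ : ∃ p', p = p' + 1 := ⟨p - 1, by omega⟩
  rw [Nat.add_sub_cancel] at *
  refine ⟨hn₀, hn₁, M, by rw [hM0, hMmid p (by omega)], by rw [hMtop, hMmid 0 hp],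
    fun k hk => ?_⟩
  obtain ⟨v, hv⟩ := layer_nonempty (i := k + 1) hconn hN₀ hlast (by omega)
  have hvX : 0 < X (k + 1) (col v) := (Set.ncard_pos (Set.toFinite _)).mpr ⟨v, hv, rfl⟩
  have hvn : 0 < n (k + 1) := by
    rw [hn]
    exact (Set.ncard_pos (Set.toFinite _)).mpr ⟨v, hv⟩
  have hvS := hmid k hk v hv
  have hS : M (k + 1) = S k := hMmid k hk
  refine ⟨hvn, by simp only [hS, S]; omega, by simp only [hS, S]; omega,
    X k, X (k + 1), X (k + 2), hX _, hX _, hX _, fun j hj => ?_, fun j hj => ?_, fun j hj => ?_⟩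
  · obtain ⟨w, hw, rfl⟩ := hXpos hj
    rcases k with - | k
    · have := hbot w hw
      simp only [hM0, S, add_assoc, zero_add, Nat.reduceAdd] at this hn₀ hn₁ ⊢
      omega
    · have := hmid k (by omega) w hw
      rw [hMmid k (by omega)]
      simp only [S, add_assoc, Nat.reduceAdd] at this ⊢
      omega
  · obtain ⟨w, hw, rfl⟩ := hXpos hj
    have := hmid k hk w hw
    simp only [hS, S]
    omega
  · obtain ⟨w, hw, rfl⟩ := hXpos hj
    by_cases hkp : k = p
    · subst hkp
      have := htop w hw
      simp only [hMtop, S, add_assoc, zero_add, Nat.reduceAdd] at this hn₀ hn₁ ⊢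
      omega
    · have := hmid (k + 1) (by omega) w hw
      rw [hMmid (k + 1) (by omega)]
      simp only [S, add_assoc, Nat.reduceAdd] at this ⊢
      omega

end Layers

theorem periodic_shift {g : ℕ → ℕ} {p : ℕ} (hp : 0 < p) (h₀ : g 0 = g p) (h₁ : g 1 = g (p + 1))
    (i : ℕ) : g ((i + 1) % p) = g (i % p + 1) ∧
      g ((i + 1) % p + 2) = g ((i + 2) % p + 1) := by
  have key : ∀ i, (i + 1) % p = if i % p + 1 = p then 0 else i % p + 1 := fun i => by
    have := Nat.mod_lt i hp
    rw [← Nat.mod_add_mod]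
    split_ifs with h
    · rw [h, Nat.mod_self]
    · exact Nat.mod_eq_of_lt (by omega)
  constructor
  · rw [key i]
    split_ifs with h
    · rw [h, h₀]
    · rfl
  · rw [key (i + 1)]
    split_ifs with h
    · rw [← h] at h₁
      exact h₁.symm
    · rfl

theorem sum_range_mul_mod (g : ℕ → ℕ) (p m : ℕ) :
    ∑ i ∈ range (m * p), g (i % p) = m * ∑ k ∈ range p, g k := by
  induction m with
  | zero => simp
  | succ m ih =>
    rw [Nat.succ_mul, sum_range_add, ih, Nat.succ_mul]
    congr 1
    refine sum_congr rfl fun k hk => ?_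
    rw [mul_comm, Nat.mul_add_mod, Nat.mod_eq_of_lt (mem_range.mp hk)]

theorem ncard_iUnion_layer {V : Type*} [Fintype V] {G : SimpleGraph V} {N₀ : Set V}
    (hN₀ : N₀.Nonempty) (p : ℕ) :
    (⋃ i ∈ range p, layer G N₀ i).ncard = ∑ i ∈ range p, (layer G N₀ i).ncard := by
  induction p with
  | zero => simp
  | succ p ih =>
    rw [sum_range_succ, ← ih, ← Set.ncard_union_eq ?_ (Set.toFinite _) (Set.toFinite _),
      range_add_one, set_biUnion_insert, Set.union_comm]
    refine Set.disjoint_left.mpr fun v hv hv' => ?_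
    simp only [Set.mem_iUnion, mem_range, mem_layer_iff hN₀] at hv hv'
    obtain ⟨i, hi, hvi⟩ := hv
    omega

theorem two_le_of_coloring {V : Type*} {G : SimpleGraph V} {K : ℕ} (col : G.Coloring (Fin K))
    {a b : V} (h : G.Adj a b) : 2 ≤ K := by
  have := Fin.val_ne_of_ne (col.valid h)
  omega

end

/-- If `G` is a repeatable graph with respect to `δ` and `χ`, with layers
`N₀, N₁, …, N_d`, then gluing copies of `G` along the isomorphic boundary layers
produces connected graphs of arbitrarily large order `n`, minimum degree `δ` and
chromatic number at most `χ` whose diameter is at least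
`((d-1)/|N₀ ∪ ⋯ ∪ N_{d-2}|)·n − O(1)`; hence `c_{δ,χ} ≥ (d−1)/|N₀ ∪ ⋯ ∪ N_{d−2}|`. -/
theorem repeatable_graph_diameter_lower_bound
    {V : Type*} [Fintype V] (G : SimpleGraph V) (δ χ : ℕ) (N₀ : Set V) (d : ℕ)
    (hconn : G.Connected) (hN₀ : N₀.Nonempty)
    (hd2 : 2 ≤ d)
    (hlast : (layer G N₀ d).Nonempty)
    (hmax : ∀ i, d < i → layer G N₀ i = ∅)
    (hiso : ∃ φ : G.induce (layer G N₀ 0 ∪ layer G N₀ 1) ≃g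
                  G.induce (layer G N₀ (d - 1) ∪ layer G N₀ d),
      (∀ x : (layer G N₀ 0 ∪ layer G N₀ 1 : Set V),
        (x : V) ∈ layer G N₀ 0 → (φ x : V) ∈ layer G N₀ (d - 1)) ∧
      (∀ x : (layer G N₀ 0 ∪ layer G N₀ 1 : Set V),
        (x : V) ∈ layer G N₀ 1 → (φ x : V) ∈ layer G N₀ d))
    (hchrom : G.chromaticNumber ≤ (χ : ℕ∞))
    (hdeg : ∀ v, v ∉ layer G N₀ 0 ∪ layer G N₀ d → δ ≤ (G.neighborSet v).ncard) :
    ∃ C : ℝ, ∀ N : ℕ, ∃ (n : ℕ) (H : SimpleGraph (Fin n)),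
      N ≤ n ∧ H.Connected ∧
      (∀ v, δ ≤ (H.neighborSet v).ncard) ∧
      H.chromaticNumber ≤ (χ : ℕ∞) ∧
      ((d - 1 : ℝ) / ((⋃ i ∈ Finset.range (d - 1), layer G N₀ i).ncard)) * n - C ≤
        (H.diam : ℝ) := by
  obtain ⟨p, hp, rfl⟩ : ∃ p, 0 < p ∧ d = p + 1 := ⟨d - 1, by omega, by omega⟩
  rw [Nat.add_sub_cancel] at hiso
  obtain ⟨φ, hφ₀, hφ₁⟩ := hiso
  obtain ⟨col⟩ := SimpleGraph.chromaticNumber_le_iff_colorable.mp hchrom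
  set n : ℕ → ℕ := fun i => (layer G N₀ i).ncard
  obtain ⟨hn₀, hn₁, M, hM₀, hM₁, hwin⟩ := exists_color_windows hp hconn hN₀ hlast hmax φ hφ₀ hφ₁
    col hdeg (n := n) fun i => rfl
  have hK : 2 ≤ χ := by
    obtain ⟨u, hu⟩ := layer_nonempty hconn hN₀ hlast (Nat.zero_le _)
    obtain ⟨w, hw⟩ := hlast
    rw [mem_layer_iff hN₀] at hu hw
    have : Nontrivial V := ⟨u, w, fun h => by subst h; omega⟩
    obtain ⟨v, hv⟩ := hconn.preconnected.exists_adj_of_nontrivial u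
    exact two_le_of_coloring col hv
  have hmod : ∀ i, i % p < p := fun i => Nat.mod_lt i hp
  have hn_shift := periodic_shift hp hn₀ hn₁
  have hM_shift := periodic_shift hp hM₀ hM₁
  obtain ⟨c, hsum, hcM, hcross⟩ := exists_color_distribution hK (fun i => n (i % p + 1))
    (fun i => M (i % p + 1)) (fun i => (hwin _ (hmod i)).1) (fun i => (hwin _ (hmod i)).2.1)
    (fun i => by
      have h := (hwin _ (hmod (i + 1))).2.2.2
      rwa [(hn_shift i).1, (hn_shift i).2, (hM_shift i).1, (hM_shift i).2] at h)
  set P := ∑ i ∈ Finset.range p, n i with hP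
  have hPpos : 0 < P := by
    have h := (hwin (p - 1) (by omega)).1
    rw [Nat.sub_add_cancel hp, ← hn₀] at h
    exact h.trans_le (Finset.single_le_sum (f := n) (fun _ _ => Nat.zero_le _)
      (Finset.mem_range.mpr hp))
  have hPsum : ∀ m, ∑ i ∈ Finset.range (m * p), n (i % p + 1) = m * P := fun m => by
    rw [sum_range_mul_mod (fun i => n (i + 1)), hP]
    have h₁ := Finset.sum_range_succ n p
    rw [Finset.sum_range_succ', ← hn₀] at h₁
    rw [Nat.add_right_cancel h₁]
  refine ⟨p / P * (4 * (δ + 1)), fun N => ?_⟩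
  obtain ⟨m, H, hm, hH, hHdeg, hHcol, hHdiam⟩ := exists_graph_of_color_distribution hK δ _
    (fun i => M (i % p + 1)) c hsum hcM hcross (fun i => by
      have h := (hwin _ (hmod (i + 1))).2.2.1
      rw [(hn_shift i).1, (hn_shift i).2] at h
      exact h.le) ((N + 1) * p) (by positivity)
  rw [hPsum] at hm
  refine ⟨m, H, ?_, hH, hHdeg, SimpleGraph.chromaticNumber_le_iff_colorable.mpr hHcol, ?_⟩
  · have := Nat.le_mul_of_pos_right (N + 1) hPpos
    omega
  · rw [Nat.add_sub_cancel, ncard_iUnion_layer hN₀, ← hP]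
    have hPR : (P : ℝ) ≠ 0 := by exact_mod_cast hPpos.ne'
    have hd : (((N + 1) * p : ℕ) : ℝ) ≤ H.diam := by exact_mod_cast hHdiam
    refine le_trans (le_of_eq ?_) hd
    rw [hm]
    push_cast
    field_simp
    ring
end
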